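/- arXiv:1910.01435 — 3 statements merged into one kernel-verified Lean document; each statement's English description precedes it below -/
import Mathlib

section
/- Let B be an n-dimensional Banach space with unit sphere S. Then the Krasnoselskii genus of S equals n, and every proper closed symmetric subset of S has Krasnoselskii genus strictly less than n. -/
open Set Metric Topology unitInterval

noncomputable section
open Classical

variable {B : Type*} [NormedAddCommGroup B] [NormedSpace ℝ B]

/-- There exists a continuous, odd, nonvanishing map `A → ℝ^m \ {0}`. -/
def HasOddMap (A : Set B) (m : ℕ) : Prop :=
  ∃ h : A → (Fin m → ℝ), Continuous h ∧ (∀ x, h x ≠ 0) ∧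
    ∀ (x : A) (hx : -(x : B) ∈ A), h ⟨-(x : B), hx⟩ = -h x

/-- Krasnoselskii genus. -/
def genus (A : Set B) : ℕ∞ :=
  if A = ∅ then 0 else sInf {m : ℕ∞ | ∃ k : ℕ, m = k ∧ HasOddMap A k}

/-- A set is contractible within the ambient space `Φ`. -/
def ContractibleIn {Φ : Type*} [TopologicalSpace Φ] (C : Set Φ) : Prop :=
  ∃ x₀ : Φ, ∃ H : C(↥C × ↥I, Φ),
    (∀ x : C, H (x, 0) = (x : Φ)) ∧ (∀ x : C, H (x, 1) = x₀)

/-- Lusternik–Schnirelmann subspace category (with closed covers). -/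
def catLS {Φ : Type*} [TopologicalSpace Φ] (A : Set Φ) : ℕ∞ :=
  sInf {m : ℕ∞ | ∃ k : ℕ, m = k ∧ ∃ C : Fin k → Set Φ,
    (∀ i, IsClosed (C i)) ∧ (∀ i, ContractibleIn (C i)) ∧ A ⊆ ⋃ i, C i}

/-- `X` can be brought to `Y` via a homotopy in `Φ` starting from the inclusion. -/
def BringsTo {Φ : Type*} [TopologicalSpace Φ] (X Y : Set Φ) : Prop :=
  ∃ H : C(↥X × ↥I, Φ),
    (∀ x : X, H (x, 0) = (x : Φ)) ∧ (∀ x : X, H (x, 1) ∈ Y)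

/-- `a` lies in the homotopy significant spectrum of `f`. -/
def HomotopySignificant {Φ : Type*} [TopologicalSpace Φ] (f : Φ → ℝ) (a : ℝ) : Prop :=
  ¬ BringsTo {x | f x ≤ a} {x | f x < a}

/-- `e` is a weak homotopy significant eigenvalue of `f`. -/
def WeakHomotopySignificant {Φ : Type*} [TopologicalSpace Φ] (f : Φ → ℝ) (e : ℝ) : Prop :=
  ∀ t₁ > e, ∀ t₂ < e, ¬ BringsTo {x | f x ≤ t₁} {x | f x ≤ t₂}

/-- The k-th Krasnoselskii eigenvalue of (the restriction to the unit sphere of) `f`. -/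
def kr (f : B → ℝ) (k : ℕ) : EReal :=
  ⨅ A ∈ {A : Set B | A ⊆ sphere (0 : B) 1 ∧ IsClosed A ∧ A = -A ∧ (k : ℕ∞) ≤ genus A},
    ⨆ x ∈ A, (f x : EReal)

/-- The k-th category (min-max) eigenvalue of `f`. -/
def hs {Φ : Type*} [TopologicalSpace Φ] (f : Φ → ℝ) (k : ℕ) : EReal :=
  ⨅ A ∈ {A : Set Φ | IsClosed A ∧ (k : ℕ∞) ≤ catLS A}, ⨆ x ∈ A, (f x : EReal)

/-- The antipodal setoid on the unit sphere of `B`. -/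
def projSetoid (B : Type*) [NormedAddCommGroup B] [NormedSpace ℝ B] :
    Setoid ↥(sphere (0 : B) 1) where
  r x y := (x : B) = y ∨ (x : B) = -(y : B)
  iseqv := by
    constructor
    · intro x; exact Or.inl rfl
    · rintro x y (h | h)
      · exact Or.inl h.symm
      · exact Or.inr (by rw [h, neg_neg])
    · rintro x y z (h | h) (h' | h')
      · exact Or.inl (h.trans h')
      · exact Or.inr (by rw [h, h'])
      · exact Or.inr (by rw [h, h'])
      · exact Or.inl (by rw [h, h', neg_neg])

/-- The projective space of `B`, as the quotient of the unit sphere by the antipodal map. -/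
def Proj (B : Type*) [NormedAddCommGroup B] [NormedSpace ℝ B] := Quotient (projSetoid B)

instance : TopologicalSpace (Proj B) := instTopologicalSpaceQuotient


section FanChains

variable {X : Type*}

/-- Mod 2 chains on finite lists of points (augmented by the empty list). -/
abbrev FCh (X : Type*) := List X →₀ ZMod 2

def fsg (l : List X) : FCh X := Finsupp.single l 1

def fcone (v : X) : FCh X →ₗ[ZMod 2] FCh X := Finsupp.lmapDomain _ _ (List.cons v)

def fpush (f : X → X) : FCh X →ₗ[ZMod 2] FCh X := Finsupp.lmapDomain _ _ (List.map f)

def fDl (φ : X → ZMod 2) : List X → FCh X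
  | [] => 0
  | v :: l => φ v • fsg l + fcone v (fDl φ l)

def fD (φ : X → ZMod 2) : FCh X →ₗ[ZMod 2] FCh X := Finsupp.linearCombination (ZMod 2) (fDl φ)

def fPl (f g : X → X) : List X → FCh X
  | [] => 0
  | v :: l => fsg (f v :: g v :: l.map g) + fcone (f v) (fPl f g l)

def fP (f g : X → X) : FCh X →ₗ[ZMod 2] FCh X := Finsupp.linearCombination (ZMod 2) (fPl f g)

theorem fadd_self (c : FCh X) : c + c = 0 := by
  rw [← two_smul (ZMod 2) c, show (2 : ZMod 2) = 0 from rfl, zero_smul]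

@[simp] theorem fcone_sg (v : X) (l : List X) : fcone v (fsg l) = fsg (v :: l) := by
  simp [fcone, fsg]

@[simp] theorem fpush_sg (f : X → X) (l : List X) : fpush f (fsg l) = fsg (l.map f) := by
  simp [fpush, fsg]

@[simp] theorem fD_sg (φ : X → ZMod 2) (l : List X) : fD φ (fsg l) = fDl φ l := by
  simp [fD, fsg]

@[simp] theorem fP_sg (f g : X → X) (l : List X) : fP f g (fsg l) = fPl f g l := by
  simp [fP, fsg]

theorem fext {M : Type*} [AddCommGroup M] [Module (ZMod 2) M] {S T : FCh X →ₗ[ZMod 2] M}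
    (h : ∀ l, S (fsg l) = T (fsg l)) : S = T := by
  apply Finsupp.lhom_ext'
  intro l
  apply LinearMap.ext_ring
  exact h l

theorem fD_cone (φ : X → ZMod 2) (v : X) (c : FCh X) :
    fD φ (fcone v c) = φ v • c + fcone v (fD φ c) := by
  have : (fD φ).comp (fcone v) = φ v • LinearMap.id + (fcone v).comp (fD φ) := by
    apply fext
    intro l
    simp [fDl]
  exact LinearMap.congr_fun this c

theorem fpush_cone (f : X → X) (v : X) (c : FCh X) :
    fpush f (fcone v c) = fcone (f v) (fpush f c) := by
  have : (fpush f).comp (fcone v) = (fcone (f v)).comp (fpush f) := by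
    apply fext
    intro l
    simp
  exact LinearMap.congr_fun this c

theorem fP_cone (f g : X → X) (v : X) (c : FCh X) :
    fP f g (fcone v c) = fcone (f v) (fcone (g v) (fpush g c)) + fcone (f v) (fP f g c) := by
  have : (fP f g).comp (fcone v) =
      (fcone (f v)).comp ((fcone (g v)).comp (fpush g)) + (fcone (f v)).comp (fP f g) := by
    apply fext
    intro l
    simp [fPl]
  exact LinearMap.congr_fun this c

theorem fD_add (φ ψ : X → ZMod 2) (c : FCh X) : fD (φ + ψ) c = fD φ c + fD ψ c := by
  have : fD (φ + ψ) = fD φ + fD ψ := by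
    apply fext
    intro l
    simp only [fD_sg, LinearMap.add_apply]
    induction l with
    | nil => simp [fDl]
    | cons v l ih => simp only [fDl, ih, Pi.add_apply, add_smul, map_add]; abel
  exact LinearMap.congr_fun this c

theorem fD_zero (c : FCh X) : fD (0 : X → ZMod 2) c = 0 := by
  have := fD_add (0 : X → ZMod 2) 0 c
  simpa using this

theorem fD_comm (φ ψ : X → ZMod 2) (c : FCh X) : fD φ (fD ψ c) = fD ψ (fD φ c) := by
  have : (fD φ).comp (fD ψ) = (fD ψ).comp (fD φ) := by
    apply fext
    intro l
    simp only [LinearMap.comp_apply, fD_sg]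
    induction l with
    | nil => simp [fDl]
    | cons v l ih => simp only [fDl, map_add, map_smul, fD_cone, ih, fD_sg]; abel
  exact LinearMap.congr_fun this c

theorem fD_sq (φ : X → ZMod 2) (c : FCh X) : fD φ (fD φ c) = 0 := by
  have : (fD φ).comp (fD φ) = 0 := by
    apply fext
    intro l
    simp only [LinearMap.comp_apply, fD_sg, LinearMap.zero_apply]
    induction l with
    | nil => simp [fDl]
    | cons v l ih =>
      simp only [fDl, map_add, map_smul, fD_cone, ih, fD_sg, map_zero, add_zero]
      exact fadd_self _
  exact LinearMap.congr_fun this c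

theorem fDl_zero (φ : X → ZMod 2) (l : List X) (h : ∀ x ∈ l, φ x = 0) : fDl φ l = 0 := by
  induction l with
  | nil => rfl
  | cons v l ih =>
    simp only [fDl]
    rw [ih (fun x hx => h x (by simp [hx])), h v (by simp)]
    simp

theorem fDD_zero (φ ψ : X → ZMod 2) (l : List X) (h : ∀ x ∈ l, ∀ y ∈ l, φ x * ψ y = 0) :
    fD φ (fD ψ (fsg l)) = 0 := by
  induction l with
  | nil => simp [fDl]
  | cons v l ih =>
    have ih' := ih (fun x hx y hy => h x (by simp [hx]) y (by simp [hy]))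
    simp only [fD_sg] at ih'
    simp only [fDl, map_add, map_smul, fD_cone, ih', fD_sg, map_zero, add_zero]
    have h1 : ψ v • fDl φ l = 0 := by
      by_cases hv : ψ v = 0
      · simp [hv]
      · rw [fDl_zero φ l, smul_zero]
        intro x hx
        have := h x (by simp [hx]) v (by simp)
        exact (mul_eq_zero.1 this).resolve_right hv
    have h2 : φ v • fDl ψ l = 0 := by
      by_cases hv : φ v = 0
      · simp [hv]
      · rw [fDl_zero ψ l, smul_zero]
        intro x hx
        have := h v (by simp) x (by simp [hx])
        exact (mul_eq_zero.1 this).resolve_left hv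
    rw [h1, h2, add_zero]

theorem fD_push (φ : X → ZMod 2) (f : X → X) (c : FCh X) :
    fD φ (fpush f c) = fpush f (fD (φ ∘ f) c) := by
  have : (fD φ).comp (fpush f) = (fpush f).comp (fD (φ ∘ f)) := by
    apply fext
    intro l
    simp only [LinearMap.comp_apply, fD_sg, fpush_sg]
    induction l with
    | nil => simp [fDl]
    | cons v l ih => simp [fDl, ih, fpush_cone]
  exact LinearMap.congr_fun this c

/-- The prism identity. -/
theorem fprism (f g : X → X) (c : FCh X) :
    fD 1 (fP f g c) + fP f g (fD 1 c) = fpush f c + fpush g c := by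
  have : (fD 1).comp (fP f g) + (fP f g).comp (fD 1) = fpush f + fpush g := by
    apply fext
    intro l
    simp only [LinearMap.comp_apply, fD_sg, fP_sg, fpush_sg, LinearMap.add_apply]
    induction l with
    | nil => simp only [fDl, fPl, map_zero, List.map_nil, add_zero]; exact (fadd_self _).symm
    | cons v l ih =>
      have e1 : fsg (f v :: g v :: l.map g) = fcone (f v) (fcone (g v) (fpush g (fsg l))) := by simp
      have e2 : fD 1 (fPl f g l) = fP f g (fDl 1 l) + (fsg (l.map f) + fsg (l.map g)) := by
        rw [← ih, add_comm (fD 1 _), ← add_assoc, fadd_self, zero_add]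
      simp only [fPl, fDl]
      rw [e1]
      have h1 : ((1 : X → ZMod 2) ∘ g) = 1 := rfl
      simp only [map_add, map_smul, fD_cone, fP_cone, Pi.one_apply, one_smul, e2,
        fP_sg, fD_push, fD_sg, h1]
      simp only [fpush_sg, fcone_sg, List.map_cons]
      generalize fcone (f v) (fcone (g v) (fpush g (fDl 1 l))) = A
      generalize fcone (f v) (fP f g (fDl 1 l)) = A2
      generalize fPl f g l = A3
      generalize fsg (f v :: l.map g) = A4
      have k1 := fadd_self A
      have k2 := fadd_self A2
      have k3 := fadd_self A3
      have k4 := fadd_self A4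
      generalize fsg (f v :: l.map f) = A5
      generalize fsg (g v :: l.map g) = A6
      calc _ = (A + A) + (A2 + A2) + (A3 + A3) + (A4 + A4) + (A5 + A6) := by abel
        _ = _ := by rw [k1, k2, k3, k4]; simp
  exact LinearMap.congr_fun this c

/-- Chains whose lists satisfy `P`. -/
def fG (P : List X → Prop) : Submodule (ZMod 2) (FCh X) := Submodule.span _ {c | ∃ l, P l ∧ c = fsg l}

theorem fG_sg {P : List X → Prop} {l : List X} (h : P l) : fsg l ∈ fG P :=
  Submodule.subset_span ⟨l, h, rfl⟩

theorem fG_map {P Q : List X → Prop} (T : FCh X →ₗ[ZMod 2] FCh X)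
    (h : ∀ l, P l → T (fsg l) ∈ fG Q) {c : FCh X} (hc : c ∈ fG P) : T c ∈ fG Q := by
  have : fG P ≤ (fG Q).comap T := by
    apply Submodule.span_le.2
    rintro _ ⟨l, hl, rfl⟩
    exact h l hl
  exact this hc

theorem fG_mono {P Q : List X → Prop} (h : ∀ l, P l → Q l) {c : FCh X} (hc : c ∈ fG P) :
    c ∈ fG Q := fG_map LinearMap.id (fun l hl => fG_sg (h l hl)) hc

theorem fG_eq {P : List X → Prop} {M : Type*} [AddCommGroup M] [Module (ZMod 2) M]
    (S T : FCh X →ₗ[ZMod 2] M)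
    (h : ∀ l, P l → S (fsg l) = T (fsg l)) {c : FCh X} (hc : c ∈ fG P) : S c = T c := by
  have : fG P ≤ LinearMap.eqLocus S T := by
    apply Submodule.span_le.2
    rintro _ ⟨l, hl, rfl⟩
    exact h l hl
  exact this hc

theorem fDl_mem (φ : X → ZMod 2) (l : List X) : fDl φ l ∈ fG (fun l' => ∀ x ∈ l', x ∈ l) := by
  induction l with
  | nil => exact Submodule.zero_mem _
  | cons v l ih =>
    refine Submodule.add_mem _ (Submodule.smul_mem _ _ (fG_sg (by simp +contextual))) ?_
    refine fG_map _ (fun l' hl' => ?_) ih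
    rw [fcone_sg]
    apply fG_sg
    simp +contextual [hl']

theorem fPl_mem (f g : X → X) (l : List X) :
    fPl f g l ∈ fG (fun l' => ∀ x ∈ l', ∃ y ∈ l, x = f y ∨ x = g y) := by
  induction l with
  | nil => exact Submodule.zero_mem _
  | cons v l ih =>
    refine Submodule.add_mem _ (fG_sg ?_) ?_
    · intro x hx
      simp only [List.mem_cons, List.mem_map] at hx
      rcases hx with rfl | rfl | ⟨y, hy, rfl⟩
      · exact ⟨v, by simp, Or.inl rfl⟩
      · exact ⟨v, by simp, Or.inr rfl⟩
      · exact ⟨y, by simp [hy], Or.inr rfl⟩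
    · refine fG_map _ (fun l' hl' => ?_) ih
      rw [fcone_sg]
      apply fG_sg
      intro x hx
      simp only [List.mem_cons] at hx
      rcases hx with rfl | hx
      · exact ⟨v, by simp, Or.inl rfl⟩
      · obtain ⟨y, hy, h⟩ := hl' x hx
        exact ⟨y, by simp [hy], h⟩

/-- all pairs related -/
def fpw (R : X → X → Prop) (l : List X) : Prop := ∀ x ∈ l, ∀ y ∈ l, R x y

theorem fD_mem {R : X → X → Prop} (φ : X → ZMod 2) {c : FCh X} (hc : c ∈ fG (fpw R)) :
    fD φ c ∈ fG (fpw R) := by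
  refine fG_map _ (fun l hl => ?_) hc
  rw [fD_sg]
  exact fG_mono (fun l' h x hx y hy => hl x (h x hx) y (h y hy)) (fDl_mem φ l)

theorem fP_mem {R Q : X → X → Prop} (f g : X → X)
    (h : ∀ x y, R x y → Q (f x) (f y) ∧ Q (f x) (g y) ∧ Q (g x) (f y) ∧ Q (g x) (g y))
    {c : FCh X} (hc : c ∈ fG (fpw R)) : fP f g c ∈ fG (fpw Q) := by
  refine fG_map _ (fun l hl => ?_) hc
  rw [fP_sg]
  refine fG_mono (fun l' h' x hx y hy => ?_) (fPl_mem f g l)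
  obtain ⟨x', hx', hx''⟩ := h' x hx
  obtain ⟨y', hy', hy''⟩ := h' y hy
  have := h x' y' (hl x' hx' y' hy')
  rcases hx'' with rfl | rfl <;> rcases hy'' with rfl | rfl <;> tauto

theorem fpush_mem {R Q : X → X → Prop} (f : X → X)
    (h : ∀ x y, R x y → Q (f x) (f y))
    {c : FCh X} (hc : c ∈ fG (fpw R)) : fpush f c ∈ fG (fpw Q) := by
  refine fG_map _ (fun l hl => ?_) hc
  rw [fpush_sg]
  apply fG_sg
  intro x hx y hy
  simp only [List.mem_map] at hx hy
  obtain ⟨x', hx', rfl⟩ := hx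
  obtain ⟨y', hy', rfl⟩ := hy
  exact h _ _ (hl x' hx' y' hy')

/-- Filling a cycle along a discrete homotopy to a constant. -/
theorem ffill {R Q : X → X → Prop} (N : ℕ) (f : ℕ → X → X) (b : X) (h0 : f 0 = id)
    (hN : ∀ x, f N x = b) (hb : Q b b)
    (h : ∀ j, j < N → ∀ x y, R x y → Q (f j x) (f j y) ∧ Q (f j x) (f (j + 1) y) ∧
      Q (f (j + 1) x) (f j y) ∧ Q (f (j + 1) x) (f (j + 1) y))
    (z : FCh X) (hz : z ∈ fG (fpw R)) (hd : fD 1 z = 0) :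
    ∃ e ∈ fG (fpw Q), fD 1 e = z := by
  have key : ∀ M, M ≤ N → ∃ e ∈ fG (fpw Q), fD 1 e = z + fpush (f M) z := by
    intro M
    induction M with
    | zero =>
      intro _
      refine ⟨0, Submodule.zero_mem _, ?_⟩
      have : fpush (f 0) z = z := by
        rw [h0]
        have : fpush (id : X → X) = LinearMap.id := fext (fun l => by simp)
        rw [this]; rfl
      rw [this, fadd_self, map_zero]
    | succ M ih =>
      intro hM
      obtain ⟨e, he, hde⟩ := ih (by omega)
      refine ⟨e + fP (f M) (f (M + 1)) z, Submodule.add_mem _ he (fP_mem _ _ (h M (by omega)) hz), ?_⟩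
      have := fprism (f M) (f (M + 1)) z
      rw [hd, map_zero, add_zero] at this
      rw [map_add, hde, this, add_assoc, ← add_assoc (fpush (f M) z), fadd_self, zero_add]
  obtain ⟨e, he, hde⟩ := key N le_rfl
  refine ⟨e + fcone b (fpush (f N) z), Submodule.add_mem _ he ?_, ?_⟩
  · have : (fcone b ∘ₗ fpush (f N)) z ∈ fG (fpw Q) := by
      refine fG_map (P := fun _ => True) _ (fun l _ => ?_) (fG_mono (fun _ _ => trivial) hz)
      simp only [LinearMap.comp_apply, fpush_sg, fcone_sg]
      apply fG_sg
      have : ∀ x ∈ b :: l.map (f N), x = b := by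
        intro x hx
        simp only [List.mem_cons, List.mem_map] at hx
        rcases hx with rfl | ⟨y, _, rfl⟩
        · rfl
        · exact hN y
      intro x hx y hy
      rw [this x hx, this y hy]
      exact hb
    exact this
  · have h1 : fD 1 (fpush (f N) z) = 0 := by
      rw [fD_push]
      have : ((1 : X → ZMod 2) ∘ f N) = 1 := rfl
      rw [this, hd, map_zero]
    rw [map_add, hde, fD_cone, h1, map_zero, add_zero, Pi.one_apply, one_smul, add_assoc,
      fadd_self, add_zero]

/-- Indicator of a label. -/
def fι (lam : X → Bool × ℕ) (s : Bool) (j : ℕ) : X → ZMod 2 := fun x => if lam x = (s, j) then 1 else 0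

def flt (lam : X → Bool × ℕ) (m : ℕ) : X → ZMod 2 := fun x => if (lam x).2 < m then 1 else 0

theorem flt_succ (lam : X → Bool × ℕ) (m : ℕ) (s : Bool) :
    flt lam (m + 1) = flt lam m + (fι lam s m + fι lam (!s) m) := by
  funext x
  simp only [flt, fι, Pi.add_apply]
  rcases hx : lam x with ⟨t, j⟩
  rcases lt_trichotomy j m with h | h | h
  · have : j < m + 1 := by omega
    have h' : j ≠ m := by omega
    simp [h, this, h']
  · subst h
    cases s <;> cases t <;> simp
  · have h1 : ¬ j < m + 1 := by omega
    have h2 : ¬ j < m := by omega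
    have h' : j ≠ m := by omega
    simp [h1, h2, h']

/-- The alternating (Fan) cochains. -/
def fF (lam : X → Bool × ℕ) : ℕ → ℕ → Bool → (FCh X →ₗ[ZMod 2] ZMod 2)
  | _, 0, _ => Finsupp.lapply []
  | 0, _ + 1, _ => 0
  | m + 1, k + 1, s => fF lam m (k + 1) s + (fF lam m k (!s)).comp (fD (fι lam s m))

theorem fF_zero (lam : X → Bool × ℕ) (m : ℕ) (s : Bool) : fF lam m 0 s = Finsupp.lapply [] := by
  cases m <;> simp [fF]

theorem fF_big (lam : X → Bool × ℕ) (m k : ℕ) (s : Bool) (h : m < k) : fF lam m k s = 0 := by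
  induction m generalizing k s with
  | zero => obtain ⟨k, rfl⟩ : ∃ k', k = k' + 1 := ⟨k - 1, by omega⟩; simp [fF]
  | succ m ih =>
    obtain ⟨k, rfl⟩ : ∃ k', k = k' + 1 := ⟨k - 1, by omega⟩
    simp [fF, ih (k + 1) s (by omega), ih k (!s) (by omega)]

theorem zadd_self (a : ZMod 2) : a + a = 0 := by
  rw [← two_mul, show (2 : ZMod 2) = 0 from rfl, zero_mul]

theorem fF_cobd (lam : X → Bool × ℕ) (R : X → X → Prop)
    (hR : ∀ x y, R x y → ∀ s j, ¬ (lam x = (s, j) ∧ lam y = (!s, j))) (m k : ℕ) (s : Bool)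
    (c : FCh X) (hc : c ∈ fG (fpw R)) :
    fF lam m k s (fD (flt lam m) c) = fF lam m (k + 1) s c + fF lam m (k + 1) (!s) c := by
  induction m generalizing k s c with
  | zero =>
    have : flt lam 0 = 0 := by funext x; simp [flt]
    rw [this, fD_zero]
    simp [fF]
  | succ m ih =>
    have hpq : fD (fι lam s m) (fD (fι lam (!s) m) c) = 0 := by
      refine fG_eq ((fD (fι lam s m)).comp (fD (fι lam (!s) m))) 0 (fun l hl => ?_) hc
      apply fDD_zero
      intro x hx y hy
      have := hR x y (hl x hx y hy) s m
      simp only [fι]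
      by_cases h : lam x = (s, m)
      · have h2 : lam y ≠ (!s, m) := fun h' => this ⟨h, h'⟩
        simp [h2]
      · simp [h]
    rw [flt_succ lam m s, fD_add, fD_add]
    cases k with
    | zero =>
      have := ih 0 s c hc
      rw [fF_zero] at this
      simp only [fF, fF_zero, map_add, this, LinearMap.add_apply, LinearMap.comp_apply]
      abel
    | succ k =>
      have i1 := ih (k + 1) s c hc
      have i2 := ih k (!s) (fD (fι lam s m) c) (fD_mem _ hc)
      simp only [fF, LinearMap.add_apply, LinearMap.comp_apply, map_add, Bool.not_not] at i2 ⊢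
      rw [i1, fD_comm _ (flt lam m), i2, fD_sq, hpq]
      simp only [map_zero, add_zero]
      have k1 := zadd_self (fF lam m (k + 1) s (fD (fι lam s m) c))
      linear_combination k1

theorem fF_push (lam : X → Bool × ℕ) (R : X → X → Prop) (ν : X → X)
    (hν : ∀ x, R x x → lam (ν x) = (!(lam x).1, (lam x).2)) (m k : ℕ) (s : Bool)
    (c : FCh X) (hc : c ∈ fG (fpw R)) :
    fF lam m k s (fpush ν c) = fF lam m k (!s) c := by
  induction m generalizing k s c with
  | zero =>
    cases k with
    | zero =>
      refine fG_eq ((fF lam 0 0 s).comp (fpush ν)) (fF lam 0 0 (!s)) (fun l hl => ?_) hc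
      simp only [LinearMap.comp_apply, fpush_sg, fF_zero]
      cases l <;> simp [fsg]
    | succ k => simp [fF]
  | succ m ih =>
    cases k with
    | zero =>
      have := ih 0 s c hc
      rwa [fF_zero, fF_zero] at this ⊢
    | succ k =>
      simp only [fF, LinearMap.add_apply, LinearMap.comp_apply]
      rw [ih _ _ _ hc, fD_push, ih _ _ _ (fD_mem _ hc)]
      congr 2
      refine fG_eq (fD (fι lam s m ∘ ν)) (fD (fι lam (!s) m)) (fun l hl => ?_) hc
      simp only [fD_sg]
      induction l with
      | nil => rfl
      | cons v l ihl =>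
        simp only [fDl]
        rw [ihl (fun x hx y hy => hl x (by simp [hx]) y (by simp [hy]))]
        congr 2
        have := hν v (hl v (by simp) v (by simp))
        simp only [fι, Function.comp_apply, this]
        rcases lam v with ⟨t, j⟩
        cases s <;> cases t <;> simp

end FanChains

section FanGeometry

/-- Points of the `ℓ¹`-sphere supported on the first `k` coordinates. -/
def fS (n k : ℕ) : Set (Fin n → ℝ) := {x | ∑ i, |x i| = 1 ∧ ∀ i : Fin n, k ≤ i → x i = 0}

def fR (n k : ℕ) (δ : ℝ) (x y : Fin n → ℝ) : Prop := x ∈ fS n k ∧ y ∈ fS n k ∧ dist x y < δ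

theorem fS_norm {n k : ℕ} {x : Fin n → ℝ} (hx : x ∈ fS n k) : ‖x‖ ≤ 1 := by
  rw [pi_norm_le_iff_of_nonneg zero_le_one]
  intro i
  rw [Real.norm_eq_abs, ← hx.1]
  exact Finset.single_le_sum (f := fun i => |x i|) (fun i _ => abs_nonneg _) (Finset.mem_univ i)

theorem fS_join {n k : ℕ} (hk : k < n) {x : Fin n → ℝ} (hx : x ∈ fS n k) {t : ℝ} (h0 : 0 ≤ t)
    (h1 : t ≤ 1) :
    (1 - t) • x + t • (Pi.single ⟨k, hk⟩ 1 : Fin n → ℝ) ∈ fS n (k + 1) := by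
  have key : ∀ i, |((1 - t) • x + t • (Pi.single ⟨k, hk⟩ 1 : Fin n → ℝ)) i| =
      (1 - t) * |x i| + t * (Pi.single ⟨k, hk⟩ 1 : Fin n → ℝ) i := by
    intro i
    simp only [Pi.add_apply, Pi.smul_apply, smul_eq_mul]
    by_cases hi : i = ⟨k, hk⟩
    · have : x i = 0 := hx.2 i (by simp [hi])
      rw [this]
      subst hi
      simp [abs_of_nonneg h0]
    · simp [Pi.single_eq_of_ne hi, abs_mul, abs_of_nonneg (sub_nonneg.2 h1)]
  refine ⟨?_, ?_⟩
  · simp only [key, Finset.sum_add_distrib, ← Finset.mul_sum, hx.1]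
    simp
  · intro i hi
    have h2 : i ≠ ⟨k, hk⟩ := by
      intro h
      simp [h] at hi
    simp [hx.2 i (by omega), Pi.single_eq_of_ne h2]

theorem fS_single {n k : ℕ} (hk : k < n) : (Pi.single ⟨k, hk⟩ 1 : Fin n → ℝ) ∈ fS n (k + 1) := by
  refine ⟨?_, ?_⟩
  · rw [Finset.sum_eq_single ⟨k, hk⟩]
    · simp
    · intro i _ hi
      simp [Pi.single_eq_of_ne hi]
    · simp
  · intro i hi
    have h2 : i ≠ ⟨k, hk⟩ := by
      intro h
      simp [h] at hi
    simp [Pi.single_eq_of_ne h2]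

theorem fS_neg {n k : ℕ} {x : Fin n → ℝ} (hx : x ∈ fS n k) : -x ∈ fS n k := by
  refine ⟨by simpa using hx.1, fun i hi => by simp [hx.2 i hi]⟩

theorem fdist {E : Type*} [NormedAddCommGroup E] [NormedSpace ℝ E] (x y b : E) (hy : ‖y‖ ≤ 1)
    (hb : ‖b‖ ≤ 1) (t u : ℝ) (h0 : 0 ≤ t) (h1 : t ≤ 1) :
    dist ((1 - t) • x + t • b) ((1 - u) • y + u • b) ≤ dist x y + |t - u| * 2 := by
  rw [dist_eq_norm, dist_eq_norm]
  have : (1 - t) • x + t • b - ((1 - u) • y + u • b) = (1 - t) • (x - y) + (t - u) • (b - y) := by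
    module
  rw [this]
  refine (norm_add_le _ _).trans ?_
  rw [norm_smul, norm_smul, Real.norm_eq_abs, Real.norm_eq_abs, abs_of_nonneg (sub_nonneg.2 h1)]
  have h3 : ‖b - y‖ ≤ 2 := (norm_sub_le _ _).trans (by linarith)
  have h4 : |t - u| * ‖b - y‖ ≤ |t - u| * 2 := mul_le_mul_of_nonneg_left h3 (abs_nonneg _)
  have h5 : (1 - t) * ‖x - y‖ ≤ ‖x - y‖ := by nlinarith [norm_nonneg (x - y)]
  linarith

theorem ffill_sphere {n k : ℕ} (hk : k < n) {δ : ℝ} (hδ : 0 < δ) (z : FCh (Fin n → ℝ))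
    (hz : z ∈ fG (fpw (fR n k (δ / 2)))) (hd : fD 1 z = 0) :
    ∃ e ∈ fG (fpw (fR n (k + 1) δ)), fD 1 e = z := by
  obtain ⟨N, hN⟩ := exists_nat_gt (4 / δ)
  have hNpos : (0 : ℝ) < N := lt_trans (by positivity) hN
  have hN2 : 1 / (N : ℝ) * 2 < δ / 2 := by
    rw [div_lt_iff₀ hδ] at hN
    rw [div_mul_eq_mul_div, div_lt_iff₀ hNpos]
    linarith
  set b : Fin n → ℝ := Pi.single ⟨k, hk⟩ 1 with hb
  have hbS := fS_single hk
  refine ffill (R := fR n k (δ / 2)) N (fun j x => (1 - (j : ℝ) / N) • x + ((j : ℝ) / N) • b) b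
    ?_ ?_ ⟨hbS, hbS, by simpa using hδ⟩ ?_ z hz hd
  · funext x; simp
  · intro x; simp [div_self hNpos.ne']
  · intro j hj x y hxy
    obtain ⟨hx, hy, hxy⟩ := hxy
    have key : ∀ i i' : ℕ, i ≤ N → i' ≤ N → |(i : ℝ) - i'| ≤ 1 →
        fR n (k + 1) δ ((1 - (i : ℝ) / N) • x + ((i : ℝ) / N) • b)
          ((1 - (i' : ℝ) / N) • y + ((i' : ℝ) / N) • b) := by
      intro i i' hi hi' hii
      have a1 : (i : ℝ) / N ≤ 1 := by rw [div_le_one hNpos]; exact_mod_cast hi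
      have a2 : (i' : ℝ) / N ≤ 1 := by rw [div_le_one hNpos]; exact_mod_cast hi'
      refine ⟨fS_join hk hx (by positivity) a1, fS_join hk hy (by positivity) a2, ?_⟩
      refine lt_of_le_of_lt (fdist x y b (fS_norm hy) (fS_norm hbS) _ _ (by positivity) a1) ?_
      have : |(i : ℝ) / N - i' / N| ≤ 1 / N := by
        rw [← sub_div, abs_div, abs_of_pos hNpos]
        gcongr
      linarith
    refine ⟨key j j hj.le hj.le (by simp), ?_, ?_, key (j + 1) (j + 1) hj hj (by simp)⟩
    · exact key j (j + 1) hj.le hj (by simp)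
    · exact key (j + 1) j hj hj.le (by simp)

theorem fcycle {n m : ℕ} (lam : (Fin n → ℝ) → Bool × ℕ) (δ₀ : ℝ)
    (hm : ∀ x, (lam x).2 < m)
    (hodd : ∀ x, x ∈ fS n n → lam (-x) = (!(lam x).1, (lam x).2))
    (hcomp : ∀ x y, fR n n δ₀ x y → ∀ s j, ¬ (lam x = (s, j) ∧ lam y = (!s, j))) (k : ℕ) (hk : k ≤ n) :
    ∀ δ, 0 < δ → δ ≤ δ₀ → ∃ z ∈ fG (fpw (fR n k δ)), fD 1 z = 0 ∧ fpush (fun x => -x) z = z ∧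
      fF lam m k true z = 1 := by
  induction k with
  | zero =>
    intro δ hδ _
    refine ⟨fsg [], fG_sg (by simp [fpw]), by simp [fDl], by simp, ?_⟩
    rw [fF_zero]
    simp [fsg]
  | succ k ih =>
    intro δ hδ hδ₀
    obtain ⟨z, hz, hdz, haz, hFz⟩ := ih (by omega) (δ / 2) (by linarith) (by linarith)
    obtain ⟨e, he, hde⟩ := ffill_sphere (by omega) hδ z hz hdz
    have hsub : ∀ x y, fR n (k + 1) δ x y → fR n n δ₀ x y := by
      rintro x y ⟨hx, hy, hxy⟩
      exact ⟨⟨hx.1, fun i hi => absurd i.2 (by omega)⟩, ⟨hy.1, fun i hi => absurd i.2 (by omega)⟩,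
        lt_of_lt_of_le hxy hδ₀⟩
    have hae : fpush (fun x => -x) e ∈ fG (fpw (fR n (k + 1) δ)) := by
      refine fpush_mem _ (fun x y h => ?_) he
      exact ⟨fS_neg h.1, fS_neg h.2.1, by rw [dist_neg_neg]; exact h.2.2⟩
    refine ⟨e + fpush (fun x => -x) e, Submodule.add_mem _ he hae, ?_, ?_, ?_⟩
    · rw [map_add, fD_push]
      have : ((1 : (Fin n → ℝ) → ZMod 2) ∘ (fun x => -x)) = 1 := rfl
      rw [this, hde, haz, fadd_self]
    · have : ∀ c : FCh (Fin n → ℝ), fpush (fun x => -x) (fpush (fun x => -x) c) = c := by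
        intro c
        have : (fpush (fun x : Fin n → ℝ => -x)).comp (fpush (fun x => -x)) = LinearMap.id := by
          apply fext
          intro l
          simp [Function.comp_def]
        exact LinearMap.congr_fun this c
      rw [map_add, this, add_comm]
    · have h1 := fF_cobd lam (fR n (k + 1) δ) (fun x y h => hcomp x y (hsub x y h)) m k true e he
      have h2 := fF_push lam (fR n (k + 1) δ) (fun x => -x)
        (fun x h => hodd x (hsub x x h).1) m (k + 1) true e he
      have h3 : flt lam m = 1 := by
        funext x
        simp [flt, hm x]
      rw [h3, hde, hFz] at h1
      rw [map_add, h2, ← h1]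

theorem fborsuk {n m : ℕ} (hmn : m < n) (g : (Fin n → ℝ) → (Fin m → ℝ))
    (hc : ContinuousOn g (fS n n)) (h0 : ∀ x ∈ fS n n, g x ≠ 0)
    (hodd : ∀ x ∈ fS n n, g (-x) = -g x) : False := by
  have hcompact : IsCompact (fS n n) := by
    refine Metric.isCompact_of_isClosed_isBounded ?_ ?_
    · have : fS n n = {x : Fin n → ℝ | ∑ i, |x i| = 1} := by
        ext x
        refine ⟨fun h => h.1, fun h => ⟨h, fun i hi => absurd i.2 (by omega)⟩⟩
      rw [this]
      exact isClosed_eq (by fun_prop) continuous_const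
    · refine (Metric.isBounded_closedBall (x := (0 : Fin n → ℝ)) (r := 1)).subset ?_
      intro x hx
      simpa using fS_norm hx
  have hne : (fS n n).Nonempty := by
    obtain ⟨k, rfl⟩ : ∃ k, n = k + 1 := ⟨n - 1, by omega⟩
    exact ⟨_, fS_single (Nat.lt_succ_self k)⟩
  obtain ⟨x₀, hx₀, hmin⟩ := hcompact.exists_isMinOn hne hc.norm
  set c := ‖g x₀‖ with hcdef
  have hcpos : 0 < c := norm_pos_iff.2 (h0 x₀ hx₀)
  have hmpos : 0 < m := by
    rcases Nat.eq_zero_or_pos m with h | h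
    · subst h
      exact absurd (Subsingleton.elim _ _) (h0 x₀ hx₀)
    · exact h
  have : Nonempty (Fin m) := ⟨⟨0, hmpos⟩⟩
  have hI : ∀ v : Fin m → ℝ, ∃ i, ∀ j, v j ≤ v i := fun v => Finite.exists_max v
  choose pickI hI using hI
  set J : (Fin n → ℝ) → Fin m := fun x => pickI (fun j => |g x j|) with hJ
  have hJc : ∀ x ∈ fS n n, c ≤ |g x (J x)| := by
    intro x hx
    have h1 : c ≤ ‖g x‖ := hmin hx
    refine h1.trans ?_
    rw [pi_norm_le_iff_of_nonneg (abs_nonneg _)]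
    intro j
    exact hI (fun j => |g x j|) j
  have huc := hcompact.uniformContinuousOn_of_continuous hc
  rw [Metric.uniformContinuousOn_iff] at huc
  obtain ⟨δ, hδ, hδ'⟩ := huc c hcpos
  set lam : (Fin n → ℝ) → Bool × ℕ := fun x => (decide (0 < g x (J x)), (J x : ℕ)) with hlam
  have hl1 : ∀ x, x ∈ fS n n → lam (-x) = (!(lam x).1, (lam x).2) := by
    intro x hx
    have hJx : J (-x) = J x := by
      simp only [hJ, hodd x hx, Pi.neg_apply, abs_neg]
    simp only [hlam, hJx, hodd x hx, Pi.neg_apply]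
    have h1 := hJc x hx
    have h2 : g x (J x) ≠ 0 := by
      intro h
      rw [h, abs_zero] at h1
      linarith
    rcases lt_or_gt_of_ne h2 with h | h
    · simp [h, h.le]
    · simp [h, h.le]
  have hl2 : ∀ x y, fR n n δ x y → ∀ s j, ¬ (lam x = (s, j) ∧ lam y = (!s, j)) := by
    rintro x y ⟨hx, hy, hxy⟩ s j ⟨h1, h2⟩
    have hd := hδ' x hx y hy hxy
    simp only [hlam, Prod.mk.injEq] at h1 h2
    have hJxy : J x = J y := Fin.ext (h1.2.trans h2.2.symm)
    have hd2 : |g x (J x) - g y (J x)| < c := by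
      rw [← Real.dist_eq]
      exact lt_of_le_of_lt (dist_le_pi_dist (g x) (g y) (J x)) hd
    have cx := hJc x hx
    have cy := hJc y hy
    rw [← hJxy] at cy h2
    rw [abs_lt] at hd2
    cases s
    · have a1 : ¬ 0 < g x (J x) := by simpa using h1.1
      have a2 : 0 < g y (J x) := by simpa using h2.1
      rw [abs_of_nonpos (not_lt.1 a1)] at cx
      rw [abs_of_pos a2] at cy
      linarith
    · have a1 : 0 < g x (J x) := by simpa using h1.1
      have a2 : ¬ 0 < g y (J x) := by simpa using h2.1
      rw [abs_of_pos a1] at cx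
      rw [abs_of_nonpos (not_lt.1 a2)] at cy
      linarith
  obtain ⟨z, hz, -, -, hF⟩ := fcycle (m := m) lam δ (fun x => (J x).2) hl1 hl2 n le_rfl δ hδ le_rfl
  rw [fF_big lam m n true hmn] at hF
  simp at hF

end FanGeometry

theorem sphere_not_hasOddMap [FiniteDimensional ℝ B] {m : ℕ} (hm : m < Module.finrank ℝ B) :
    ¬ HasOddMap (sphere (0 : B) 1) m := by
  rintro ⟨h, hcont, hne, hodd⟩
  set n := Module.finrank ℝ B with hn
  let φ : (Fin n → ℝ) ≃L[ℝ] B := ContinuousLinearEquiv.ofFinrankEq (by simp [hn])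
  have hx0 : ∀ x ∈ fS n n, φ x ≠ 0 := by
    intro x hx h
    have : x = 0 := by simpa using h
    have h1 := hx.1
    simp [this] at h1
  have hmem : ∀ x : B, x ≠ 0 → ‖x‖⁻¹ • x ∈ sphere (0 : B) 1 := by
    intro x hx
    simp [norm_smul, norm_ne_zero_iff.2 hx]
  let g : (Fin n → ℝ) → (Fin m → ℝ) := fun x =>
    if hx : φ x ≠ 0 then h ⟨‖φ x‖⁻¹ • φ x, hmem _ hx⟩ else 0
  have hg : ∀ x (hx : φ x ≠ 0), g x = h ⟨‖φ x‖⁻¹ • φ x, hmem _ hx⟩ := by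
    intro x hx
    simp only [g]
    rw [dif_pos hx]
  refine fborsuk hm g ?_ ?_ ?_
  · rw [continuousOn_iff_continuous_domRestrict]
    have : (fS n n).domRestrict g = fun x : fS n n =>
        h ⟨‖φ x‖⁻¹ • φ x, hmem _ (hx0 x x.2)⟩ := by
      funext x
      exact hg x (hx0 x x.2)
    rw [this]
    refine hcont.comp (Continuous.subtype_mk ?_ _)
    have hc1 : Continuous fun x : fS n n => φ (x : Fin n → ℝ) := φ.continuous.comp continuous_subtype_val
    exact (hc1.norm.inv₀ (fun x => norm_ne_zero_iff.2 (hx0 x x.2))).smul hc1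
  · intro x hx
    rw [hg x (hx0 x hx)]
    exact hne _
  · intro x hx
    rw [hg x (hx0 x hx), hg (-x) (hx0 _ (fS_neg hx))]
    have h1 : -(‖φ x‖⁻¹ • φ x) ∈ sphere (0 : B) 1 := by
      have := hmem _ (hx0 x hx)
      simpa using this
    rw [← hodd ⟨‖φ x‖⁻¹ • φ x, hmem _ (hx0 x hx)⟩ h1]
    congr 2
    simp

theorem genus_le_of_hasOddMap {A : Set B} {k : ℕ} (h : HasOddMap A k) : genus A ≤ k := by
  unfold genus
  split_ifs
  · exact zero_le
  · exact sInf_le ⟨k, rfl, h⟩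

theorem hasOddMap_of_linear
    [FiniteDimensional ℝ B]
    {A : Set B} {k : ℕ} (L : B →ₗ[ℝ] (Fin k → ℝ)) (h : ∀ x ∈ A, L x ≠ 0) : HasOddMap A k :=
  ⟨fun x => L x, (LinearMap.continuous_of_finiteDimensional L).comp continuous_subtype_val,
    fun x => h x x.2, fun x hx => by simp⟩

/-- The unit sphere of an `n`-dimensional Banach space has Krasnoselskii genus `n`,
and every proper closed symmetric subset of the sphere has genus strictly less than `n`. -/
theorem genus_sphere_and_proper_subsets [CompleteSpace B] [FiniteDimensional ℝ B]
    {n : ℕ} (hn : Module.finrank ℝ B = n) :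
    genus (sphere (0 : B) 1) = (n : ℕ∞) ∧
    ∀ A : Set B, A ⊆ sphere (0 : B) 1 → A ≠ sphere (0 : B) 1 → IsClosed A → A = -A →
      genus A < (n : ℕ∞) := by
  have hfull : ∀ A : Set B, A ⊆ sphere (0 : B) 1 → genus A ≤ n := by
    intro A hA
    let φ : B ≃ₗ[ℝ] (Fin n → ℝ) := LinearEquiv.ofFinrankEq _ _ (by simp [hn])
    refine genus_le_of_hasOddMap (hasOddMap_of_linear φ.toLinearMap ?_)
    intro x hx h
    have h0 : x = 0 := by simpa using h
    have := hA hx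
    simp [h0] at this
  refine ⟨le_antisymm (hfull _ subset_rfl) ?_, ?_⟩
  · unfold genus
    split_ifs with hS
    · have : n = 0 := by
        by_contra hne
        have : Nontrivial B := Module.nontrivial_of_finrank_pos (R := ℝ) (by omega)
        have := NormedSpace.sphere_nonempty (x := (0 : B)) (r := 1)
        rw [hS] at this
        simp at this
      simp [this]
    · refine le_sInf ?_
      rintro _ ⟨k, rfl, hk⟩
      by_contra hlt
      rw [not_le] at hlt
      exact sphere_not_hasOddMap (by rw [hn]; exact_mod_cast hlt) hk
  · intro A hA hne _ hsymm
    obtain ⟨x₀, hx₀, hx₀A⟩ : ∃ x ∈ sphere (0 : B) 1, x ∉ A := by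
      by_contra hcon
      push Not at hcon
      exact hne (Subset.antisymm hA hcon)
    have hx₀' : -x₀ ∉ A := by
      intro h
      rw [hsymm] at h
      simp at h
      exact hx₀A h
    have hx₀n : ‖x₀‖ = 1 := by simpa using hx₀
    have hx₀0 : x₀ ≠ 0 := by
      intro h
      simp [h] at hx₀n
    have hfin : Module.finrank ℝ (B ⧸ (ℝ ∙ x₀)) = n - 1 := by
      have := Submodule.finrank_quotient_add_finrank (ℝ ∙ x₀)
      rw [finrank_span_singleton hx₀0, hn] at this
      omega
    have hnpos : 0 < n := by
      have : Nontrivial B := ⟨x₀, 0, hx₀0⟩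
      rw [← hn]
      exact Module.finrank_pos
    let ψ : (B ⧸ (ℝ ∙ x₀)) ≃ₗ[ℝ] (Fin (n - 1) → ℝ) := LinearEquiv.ofFinrankEq _ _ (by simp [hfin])
    have hA' : HasOddMap A (n - 1) := by
      refine hasOddMap_of_linear (ψ.toLinearMap.comp (ℝ ∙ x₀).mkQ) ?_
      intro x hx h
      have h0 : x ∈ (ℝ ∙ x₀) := by simpa using h
      obtain ⟨r, rfl⟩ := Submodule.mem_span_singleton.1 h0
      have h1 := hA hx
      rw [mem_sphere_zero_iff_norm, norm_smul, hx₀n, mul_one, Real.norm_eq_abs] at h1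
      rcases (abs_eq zero_le_one).1 h1 with rfl | rfl
      · rw [one_smul] at hx
        exact hx₀A hx
      · rw [neg_one_smul] at hx
        exact hx₀' hx
    refine lt_of_le_of_lt (genus_le_of_hasOddMap hA') ?_
    exact_mod_cast Nat.sub_lt hnpos one_pos

end
end

section
/- Let B be a Banach space with unit sphere S and projective space Φ, and let f : Φ → ℝ be continuous. Then kr₂ = hs₂ = inf over non-contractible loops ℓ : [0,1] → Φ of sup_{s ∈ [0,1]} f(ℓ(s)). -/
open Set Metric Topology unitInterval

noncomputable section
open Classical

variable {B : Type*} [NormedAddCommGroup B] [NormedSpace ℝ B]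

/-- A loop `ℓ` is null-homotopic in `Φ` if it can be contracted, through loops,
to a constant. -/
def NullHomotopicLoop {Φ : Type*} [TopologicalSpace Φ] (ℓ : C(↥I, Φ)) : Prop :=
  ∃ x₀ : Φ, ∃ H : C(↥I × ↥I, Φ),
    (∀ s, H (s, 0) = ℓ s) ∧ (∀ s, H (s, 1) = x₀) ∧ ∀ t, H (0, t) = H (1, t)

/-- The projection from the sphere. -/
def qP (x : ↥(sphere (0 : B) 1)) : Proj B := Quotient.mk (projSetoid B) x

theorem qP_isQuotientMap : IsQuotientMap (qP (B := B)) := isQuotientMap_quotient_mk'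

theorem qP_eq_iff (x y : ↥(sphere (0 : B) 1)) : qP x = qP y ↔ x = y ∨ x = -y := by
  have key : qP x = qP y ↔ ((x : B) = y ∨ (x : B) = -(y : B)) :=
    ⟨fun h => Quotient.exact (s := projSetoid B) h, fun h => Quotient.sound (s := projSetoid B) h⟩
  rw [key]
  constructor
  · rintro (h | h)
    · exact Or.inl (Subtype.ext h)
    · exact Or.inr (Subtype.ext h)
  · rintro (h | h)
    · exact Or.inl (by rw [h])
    · exact Or.inr (by rw [h]; rfl)

theorem qP_neg (x : ↥(sphere (0 : B) 1)) : qP (-x) = qP x := (qP_eq_iff _ _).2 (Or.inr rfl)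

theorem sphere_ne_neg (x : ↥(sphere (0 : B) 1)) : x ≠ -x := by
  intro h
  have h1 : (x : B) = -(x : B) := congrArg Subtype.val h
  have h2 : (x : B) = 0 := by
    have h4 : (2 : ℝ) • (x : B) = 0 := by
      rw [two_smul]
      exact add_eq_zero_iff_eq_neg.2 h1
    exact (smul_eq_zero.1 h4).resolve_left two_ne_zero
  have h3 : ‖(x : B)‖ = 1 := by simp
  rw [h2] at h3
  simp at h3

theorem qP_isOpenQuotientMap : IsOpenQuotientMap (qP (B := B)) := by
  refine ⟨qP_isQuotientMap.surjective, qP_isQuotientMap.continuous, ?_⟩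
  intro U hU
  rw [← qP_isQuotientMap.isOpen_preimage]
  have : qP ⁻¹' (qP '' U) = U ∪ (fun x : ↥(sphere (0 : B) 1) => -x) ⁻¹' U := by
    ext x
    constructor
    · rintro ⟨y, hy, hxy⟩
      rcases (qP_eq_iff _ _).1 hxy with h | h
      · left; rwa [← h]
      · right; show -x ∈ U; rwa [← h]
    · rintro (h | h)
      · exact ⟨x, h, rfl⟩
      · exact ⟨-x, h, qP_neg x⟩
  rw [this]
  exact hU.union (hU.preimage continuous_neg)

/-- The sign action on the sphere. -/
def sgnAction : MulAction ℤˣ ↥(sphere (0 : B) 1) where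
  smul g x := if g = 1 then x else -x
  one_smul x := if_pos rfl
  mul_smul g h x := by
    show (if g * h = 1 then x else -x) = (if g = 1 then (if h = 1 then x else -x)
      else -(if h = 1 then x else -x))
    rcases Int.units_eq_one_or g with rfl | rfl <;> rcases Int.units_eq_one_or h with rfl | rfl <;>
      simp

theorem qP_isCoveringMap : IsCoveringMap (qP (B := B)) := by
  letI := sgnAction (B := B)
  have h1 : ∀ x : ↥(sphere (0 : B) 1), (1 : ℤˣ) • x = x := fun x => one_smul _ x
  have h2 : ∀ x : ↥(sphere (0 : B) 1), (-1 : ℤˣ) • x = -x := fun x => if_neg (by decide)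
  have key : IsQuotientCoveringMap (qP (B := B)) ℤˣ :=
    { qP_isQuotientMap with
      continuous_const_smul := by
        intro g
        rcases Int.units_eq_one_or g with rfl | rfl
        · simp only [h1]; exact continuous_id
        · simp only [h2]; exact continuous_neg
      apply_eq_iff_mem_orbit := by
        intro x y
        rw [qP_eq_iff]
        constructor
        · rintro (h | h)
          · exact ⟨1, by rw [h]; exact h1 y⟩
          · exact ⟨-1, by rw [h]; exact h2 y⟩
        · rintro ⟨g, hg⟩
          rcases Int.units_eq_one_or g with rfl | rfl
          · left; rw [← hg]; exact h1 y
          · right; rw [← hg]; exact h2 y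
      disjoint := by
        intro e
        obtain ⟨U, V, hU, hV, heU, heV, hd⟩ := t2_separation (sphere_ne_neg e)
        refine ⟨U ∩ (fun x => -x) ⁻¹' V, (hU.inter (hV.preimage continuous_neg)).mem_nhds
          ⟨heU, heV⟩, ?_⟩
        intro g hg
        rcases Int.units_eq_one_or g with rfl | rfl
        · rfl
        · exfalso
          obtain ⟨z, ⟨y, hy, rfl⟩, hz⟩ := hg
          have hz' : -y ∈ U := by rw [← h2 y]; exact hz.1
          exact Set.disjoint_left.1 hd hz' hy.2 }
  exact key.isCoveringMap

theorem not_null_of_antipodal (γ : C(↥I, ↥(sphere (0 : B) 1))) (hγ : γ 1 = -γ 0)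
    (ℓ : C(↥I, Proj B)) (hℓ : ∀ s, ℓ s = qP (γ s)) : ¬ NullHomotopicLoop ℓ := by
  rintro ⟨x₀, H, H0, H1, Hl⟩
  have cov := qP_isCoveringMap (B := B)
  let K : C(↥I × ↥I, Proj B) := H.comp ⟨fun p => (p.2, p.1), by fun_prop⟩
  have hK0 : ∀ a, K (0, a) = qP (γ a) := fun a => (H0 a).trans (hℓ a)
  let L := cov.liftHomotopy K γ hK0
  have hL : ∀ t s, qP (L (t, s)) = H (s, t) := fun t s =>
    congr_fun (cov.liftHomotopy_lifts K γ hK0) (t, s)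
  have hL0 : ∀ s, L (0, s) = γ s := cov.liftHomotopy_zero K γ hK0
  have e1 : (fun t : ↥I => L (t, 1)) = fun t => -L (t, 0) := by
    refine cov.eq_of_comp_eq (by fun_prop) (by fun_prop) ?_ 0 ?_
    · funext t
      show qP (L (t, 1)) = qP (-L (t, 0))
      rw [qP_neg, hL, hL, Hl]
    · show L (0, 1) = -L (0, 0)
      rw [hL0, hL0, hγ]
  have e2 : (fun s : ↥I => L (1, s)) = fun _ => L (1, 0) := by
    refine cov.eq_of_comp_eq (by fun_prop) (by fun_prop) ?_ 0 rfl
    funext s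
    show qP (L (1, s)) = qP (L (1, 0))
    rw [hL, hL, H1, H1]
  have a1 := congr_fun e1 1
  have a2 := congr_fun e2 1
  exact sphere_ne_neg (L (1, 0)) (a2.symm.trans a1)

theorem path_or_odd (V : Set B) (hV : IsOpen V) (hneg : ∀ x ∈ V, -x ∈ V) :
    (∃ x, JoinedIn V x (-x)) ∨ ∃ g : V → ℝ, Continuous g ∧ (∀ x, g x ≠ 0) ∧
      ∀ x : V, g ⟨-(x : B), hneg x x.2⟩ = - g x := by
  by_cases hj : ∃ x, JoinedIn V x (-x)
  · exact Or.inl hj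
  right
  have : LocallyPathConnectedSpace V := hV.locallyPathConnectedSpace
  letI : LinearOrder (ZerothHomotopy V) := linearOrderOfSTO WellOrderingRel
  let nV : V → V := fun x => ⟨-(x : B), hneg x x.2⟩
  have hnV : Continuous nV := by fun_prop
  have hnn : ∀ x, nV (nV x) = x := fun x => Subtype.ext (neg_neg _)
  let p : V → ZerothHomotopy V := ZerothHomotopy.mk
  have hp : Continuous p := continuous_quotient_mk'
  have hne : ∀ x, p x ≠ p (nV x) := by
    intro x h
    have h' : Joined x (nV x) := Quotient.exact h
    apply hj
    refine ⟨x, ?_⟩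
    exact (joinedIn_iff_joined x.2 (nV x).2).2 h'
  refine ⟨fun x => if p x < p (nV x) then 1 else -1, ?_, ?_, ?_⟩
  · have : Continuous (fun x => (p x, p (nV x))) := hp.prodMk (hp.comp hnV)
    exact (continuous_of_discreteTopology
      (f := fun c : ZerothHomotopy V × ZerothHomotopy V => if c.1 < c.2 then (1 : ℝ) else -1)).comp
      this
  · intro x
    dsimp only
    split_ifs <;> norm_num
  · intro x
    show (if p (nV x) < p (nV (nV x)) then (1 : ℝ) else -1) = -(if p x < p (nV x) then 1 else -1)
    rw [hnn]
    rcases lt_or_gt_of_ne (hne x) with h | h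
    · rw [if_pos h, if_neg h.not_gt]
    · rw [if_pos h, if_neg h.not_gt, neg_neg]

/-- Normalization as a point of the sphere. -/
def nrm (y : B) (hy : y ≠ 0) : ↥(sphere (0 : B) 1) :=
  ⟨‖y‖⁻¹ • y, by simp [norm_smul, hy]⟩

theorem continuous_nrm {X : Type*} [TopologicalSpace X] (g : X → B) (hg : Continuous g)
    (h0 : ∀ x, g x ≠ 0) : Continuous fun x => nrm (g x) (h0 x) := by
  unfold nrm
  refine Continuous.subtype_mk ?_ _
  exact (hg.norm.inv₀ fun x => norm_ne_zero_iff.2 (h0 x)).smul hg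

theorem nrm_neg (y : B) (hy : y ≠ 0) (hy' : -y ≠ 0) : nrm (-y) hy' = -nrm y hy := by
  apply Subtype.ext
  show ‖-y‖⁻¹ • (-y) = -(‖y‖⁻¹ • y)
  rw [norm_neg, smul_neg]

theorem nrm_self (x : ↥(sphere (0 : B) 1)) (hx : (x : B) ≠ 0) : nrm (x : B) hx = x := by
  apply Subtype.ext
  show ‖(x : B)‖⁻¹ • (x : B) = x
  have h3 : ‖(x : B)‖ = 1 := by simp
  rw [h3, inv_one, one_smul]

theorem sphere_coe_ne (x : ↥(sphere (0 : B) 1)) : (x : B) ≠ 0 := by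
  intro h2
  have h3 : ‖(x : B)‖ = 1 := by simp
  rw [h2] at h3
  simp at h3

theorem two_le_genus_iff (A : Set B) :
    (((2 : ℕ) : ℕ∞) ≤ genus A) ↔ A.Nonempty ∧ ¬ HasOddMap A 1 := by
  unfold genus
  constructor
  · intro h
    split_ifs at h with hA
    · exact absurd h (by decide)
    refine ⟨Set.nonempty_iff_ne_empty.2 hA, fun h1 => ?_⟩
    have := h.trans (sInf_le ⟨1, rfl, h1⟩)
    exact absurd (Nat.cast_le.1 this) (by decide)
  · rintro ⟨hA, h1⟩
    rw [if_neg hA.ne_empty]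
    refine le_sInf ?_
    rintro m ⟨k, rfl, hk⟩
    rw [Nat.cast_le]
    by_contra hlt
    have : k = 0 ∨ k = 1 := by omega
    rcases this with rfl | rfl
    · obtain ⟨h, -, hh, -⟩ := hk
      obtain ⟨a, ha⟩ := hA
      exact hh ⟨a, ha⟩ (Subsingleton.elim _ _)
    · exact h1 hk

theorem two_le_catLS_iff {Φ : Type*} [TopologicalSpace Φ] (A : Set Φ) (hA : IsClosed A) :
    (((2 : ℕ) : ℕ∞) ≤ catLS A) ↔ A.Nonempty ∧ ¬ ContractibleIn A := by
  unfold catLS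
  constructor
  · intro h
    constructor
    · by_contra hE
      rw [Set.not_nonempty_iff_eq_empty] at hE
      have := h.trans (sInf_le ⟨0, rfl, fun _ => ∅, fun i => i.elim0, fun i => i.elim0, by
        rw [hE]; exact Set.empty_subset _⟩)
      exact absurd (Nat.cast_le.1 this) (by decide)
    · intro hc
      have := h.trans (sInf_le ⟨1, rfl, fun _ => A, fun _ => hA, fun _ => hc,
        fun x hx => Set.mem_iUnion.2 ⟨0, hx⟩⟩)
      exact absurd (Nat.cast_le.1 this) (by decide)
  · rintro ⟨hne, hc⟩
    refine le_sInf ?_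
    rintro m ⟨k, rfl, C, -, hC, hAC⟩
    rw [Nat.cast_le]
    by_contra hlt
    have : k = 0 ∨ k = 1 := by omega
    rcases this with rfl | rfl
    · obtain ⟨a, ha⟩ := hne
      obtain ⟨i, -⟩ := Set.mem_iUnion.1 (hAC ha)
      exact i.elim0
    · have hsub : A ⊆ C 0 := by
        intro a ha
        obtain ⟨i, hi⟩ := Set.mem_iUnion.1 (hAC ha)
        rwa [Subsingleton.elim 0 i]
      obtain ⟨x₀, H, h0, h1⟩ := hC 0
      refine hc ⟨x₀, H.comp ⟨fun p => (⟨p.1, hsub p.1.2⟩, p.2), by fun_prop⟩, ?_, ?_⟩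
      · intro x; exact h0 ⟨x, hsub x.2⟩
      · intro x; exact h1 ⟨x, hsub x.2⟩

/-- First inequality: category value is at most the loop value. -/
theorem hs_le_loops (f : Proj B → ℝ) (hf : Continuous f) :
    hs f 2 ≤ ⨅ ℓ ∈ {ℓ : C(↥I, Proj B) | ℓ 0 = ℓ 1 ∧ ¬ NullHomotopicLoop ℓ},
      ⨆ s : ↥I, (f (ℓ s) : EReal) := by
  refine le_iInf₂ ?_
  rintro ℓ ⟨hloop, hnn⟩
  set c : EReal := ⨆ s : ↥I, (f (ℓ s) : EReal) with hc
  let A : Set (Proj B) := {x | (f x : EReal) ≤ c}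
  have hA : IsClosed A := isClosed_le (continuous_coe_real_ereal.comp hf) continuous_const
  have hmem : ∀ s, ℓ s ∈ A := fun s => le_iSup (fun s : ↥I => (f (ℓ s) : EReal)) s
  refine (iInf₂_le A ⟨hA, (two_le_catLS_iff A hA).2 ⟨⟨_, hmem 0⟩, ?_⟩⟩).trans
    (iSup₂_le fun x hx => hx)
  rintro ⟨x₀, H, h0, h1⟩
  refine hnn ⟨x₀, H.comp ⟨fun p => (⟨ℓ p.1, hmem p.1⟩, p.2), by fun_prop⟩, ?_, ?_, ?_⟩
  · intro s; exact h0 _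
  · intro s; exact h1 _
  · intro t
    simp only [ContinuousMap.comp_apply, ContinuousMap.coe_mk, hloop]

theorem contractible_of_oddMap (A : Set (Proj B)) (hne : A.Nonempty)
    (h : HasOddMap (Subtype.val '' (qP ⁻¹' A) : Set B) 1) : ContractibleIn A := by
  obtain ⟨h, hc, h0, hodd⟩ := h
  have hm : ∀ x : ↥(qP ⁻¹' A), ((x : ↥(sphere (0 : B) 1)) : B) ∈
      (Subtype.val '' (qP ⁻¹' A) : Set B) := fun x => ⟨x, x.2, rfl⟩
  let g : ↥(qP ⁻¹' A) → ℝ := fun x => h ⟨_, hm x⟩ 0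
  have hg : Continuous g := by
    have : Continuous fun x : ↥(qP ⁻¹' A) => h ⟨_, hm x⟩ := hc.comp (by fun_prop)
    exact (continuous_apply 0).comp this
  have hg0 : ∀ x, g x ≠ 0 := by
    intro x hx
    apply h0 ⟨_, hm x⟩
    funext i
    rw [Subsingleton.elim i 0]
    exact hx
  have hnegmem : ∀ x : ↥(qP ⁻¹' A), -(x : ↥(sphere (0 : B) 1)) ∈ qP ⁻¹' A := by
    intro x
    show qP _ ∈ A
    rw [qP_neg]
    exact x.2
  have hgodd : ∀ x : ↥(qP ⁻¹' A), g ⟨-x, hnegmem x⟩ = -g x := by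
    intro x
    have := hodd ⟨_, hm x⟩ (hm ⟨-x, hnegmem x⟩)
    exact congr_fun this 0
  let rep : ↥(qP ⁻¹' A) → ↥(sphere (0 : B) 1) := fun x =>
    nrm (g x • ((x : ↥(sphere (0 : B) 1)) : B)) (smul_ne_zero (hg0 x) (sphere_coe_ne _))
  have hrep_c : Continuous rep := continuous_nrm _ (by fun_prop) _
  have hrep_neg : ∀ x : ↥(qP ⁻¹' A), rep ⟨-x, hnegmem x⟩ = rep x := by
    intro x
    apply Subtype.ext
    show ‖g ⟨-x, hnegmem x⟩ • (-((x : ↥(sphere (0 : B) 1)) : B))‖⁻¹ •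
      (g ⟨-x, hnegmem x⟩ • (-((x : ↥(sphere (0 : B) 1)) : B))) = ‖g x • _‖⁻¹ • (g x • _)
    rw [hgodd, neg_smul_neg]
  have hrep_cases : ∀ x : ↥(qP ⁻¹' A), (0 < g x ∧ rep x = x) ∨ (g x < 0 ∧ rep x = -x) := by
    intro x
    have hn : ‖((x : ↥(sphere (0 : B) 1)) : B)‖ = 1 := by simp
    rcases lt_or_gt_of_ne (hg0 x) with hx | hx
    · right
      refine ⟨hx, Subtype.ext ?_⟩
      show ‖g x • ((x : ↥(sphere (0 : B) 1)) : B)‖⁻¹ • (g x • ((x : ↥(sphere (0 : B) 1)) : B)) =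
        -((x : ↥(sphere (0 : B) 1)) : B)
      rw [norm_smul, hn, mul_one, Real.norm_eq_abs, abs_of_neg hx, smul_smul, inv_neg, neg_mul,
        inv_mul_cancel₀ hx.ne, neg_one_smul]
    · left
      refine ⟨hx, Subtype.ext ?_⟩
      show ‖g x • ((x : ↥(sphere (0 : B) 1)) : B)‖⁻¹ • (g x • ((x : ↥(sphere (0 : B) 1)) : B)) =
        ((x : ↥(sphere (0 : B) 1)) : B)
      rw [norm_smul, hn, mul_one, Real.norm_eq_abs, abs_of_pos hx, smul_smul,
        inv_mul_cancel₀ hx.ne', one_smul]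
  have hrep_q : ∀ x, qP (rep x) = qP x := by
    intro x
    rcases hrep_cases x with ⟨-, h⟩ | ⟨-, h⟩ <;> rw [h]
    exact qP_neg _
  have hrep_mem : ∀ x, rep x ∈ qP ⁻¹' A := by
    intro x
    show qP _ ∈ A
    rw [hrep_q]
    exact x.2
  have hrep_pos : ∀ x, 0 < g ⟨rep x, hrep_mem x⟩ := by
    intro x
    rcases hrep_cases x with ⟨hx, h⟩ | ⟨hx, h⟩
    · have : (⟨rep x, hrep_mem x⟩ : ↥(qP ⁻¹' A)) = x := Subtype.ext h
      rw [this]; exact hx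
    · have : (⟨rep x, hrep_mem x⟩ : ↥(qP ⁻¹' A)) = ⟨-x, hnegmem x⟩ := Subtype.ext h
      rw [this, hgodd]; linarith
  have hanti : ∀ x y, rep x ≠ -rep y := by
    intro x y hxy
    have h1 := hrep_pos x
    have : (⟨rep x, hrep_mem x⟩ : ↥(qP ⁻¹' A)) = ⟨-rep y, hnegmem ⟨rep y, hrep_mem y⟩⟩ :=
      Subtype.ext hxy
    rw [this, hgodd ⟨rep y, hrep_mem y⟩] at h1
    linarith [hrep_pos y]
  have hQ : IsOpenQuotientMap (A.restrictPreimage (qP (B := B))) :=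
    qP_isOpenQuotientMap.restrictPreimage A
  let r : A → ↥(qP ⁻¹' A) := Function.surjInv hQ.surjective
  have hr : ∀ a, A.restrictPreimage qP (r a) = a := Function.surjInv_eq hQ.surjective
  let ρ : A → ↥(sphere (0 : B) 1) := fun a => rep (r a)
  have hρcomp : ρ ∘ (A.restrictPreimage qP) = rep := by
    funext x
    have h1 : qP (r (A.restrictPreimage qP x) : ↥(sphere (0 : B) 1)) = qP x :=
      congrArg Subtype.val (hr (A.restrictPreimage qP x))
    show rep (r (A.restrictPreimage qP x)) = rep x
    rcases (qP_eq_iff _ _).1 h1 with h | h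
    · rw [Subtype.ext h]
    · rw [← hrep_neg x]
      exact congrArg rep (Subtype.ext h)
  have hρ : Continuous ρ := by
    rw [hQ.isQuotientMap.continuous_iff, hρcomp]
    exact hrep_c
  have hρq : ∀ a, qP (ρ a) = a := by
    intro a
    show qP (rep (r a)) = a
    rw [hrep_q]
    exact congrArg Subtype.val (hr a)
  obtain ⟨a₀, ha₀⟩ := hne
  let z := ρ ⟨a₀, ha₀⟩
  let G : A × ↥I → B := fun p => (1 - (p.2 : ℝ)) • (ρ p.1 : B) + (p.2 : ℝ) • (z : B)
  have hGc : Continuous G := by fun_prop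
  have hG0 : ∀ p, G p ≠ 0 := by
    rintro ⟨a, t⟩ hz
    have e : (1 - (t : ℝ)) • (ρ a : B) = -((t : ℝ) • (z : B)) := eq_neg_of_add_eq_zero_left hz
    have hn1 : ‖(ρ a : B)‖ = 1 := by simp
    have hn2 : ‖(z : B)‖ = 1 := by simp
    have e2 := congrArg norm e
    rw [norm_neg, norm_smul, norm_smul, hn1, hn2, Real.norm_eq_abs, Real.norm_eq_abs,
      abs_of_nonneg t.2.1, abs_of_nonneg (by linarith [t.2.2])] at e2
    have ht : (t : ℝ) = 1 / 2 := by linarith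
    have e3 : (ρ a : B) = -(z : B) := by
      rw [ht, ← smul_neg] at e
      have h12 : (1 - 1 / 2 : ℝ) = 1 / 2 := by norm_num
      rw [h12] at e
      exact smul_right_injective B (by norm_num : (1 / 2 : ℝ) ≠ 0) e
    exact hanti _ _ (Subtype.ext e3)
  refine ⟨qP z, ⟨fun p => qP (nrm (G p) (hG0 p)),
    qP_isQuotientMap.continuous.comp (continuous_nrm G hGc hG0)⟩, ?_, ?_⟩
  · intro a
    show qP (nrm (G (a, 0)) _) = a
    have : G (a, 0) = ρ a := by simp [G]
    simp only [this, nrm_self, hρq]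
  · intro a
    show qP (nrm (G (a, 1)) _) = qP z
    have : G (a, 1) = z := by simp [G]
    simp only [this, nrm_self]

theorem kr_le_hs (f : Proj B → ℝ) (F : B → ℝ)
    (hF : ∀ x (hx : x ∈ sphere (0 : B) 1),
      F x = f (Quotient.mk (projSetoid B) ⟨x, hx⟩)) : kr F 2 ≤ hs f 2 := by
  refine le_iInf₂ ?_
  rintro A ⟨hA, hcat⟩
  obtain ⟨hne, hnc⟩ := (two_le_catLS_iff A hA).1 hcat
  have hsymm : ∀ y : B, y ∈ (Subtype.val '' (qP ⁻¹' A) : Set B) →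
      -y ∈ (Subtype.val '' (qP ⁻¹' A) : Set B) := by
    rintro _ ⟨x, hx, rfl⟩
    refine ⟨-x, ?_, rfl⟩
    show qP _ ∈ A
    rw [qP_neg]; exact hx
  refine le_trans (b := ⨆ x ∈ (Subtype.val '' (qP ⁻¹' A) : Set B), (F x : EReal))
    (iInf₂_le _ ?_) ?_
  rotate_left
  · refine iSup₂_le ?_
    rintro _ ⟨x, hx, rfl⟩
    rw [hF x x.2]
    exact le_iSup₂ (f := fun (y : Proj B) (_ : y ∈ A) => (f y : EReal)) (qP x) hx
  refine ⟨?_, ?_, ?_, ?_⟩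
  · rintro _ ⟨x, -, rfl⟩; exact x.2
  · exact (isClosed_sphere.isClosedEmbedding_subtypeVal).isClosedMap _
      (hA.preimage qP_isQuotientMap.continuous)
  · ext y
    constructor
    · intro hy; exact hsymm y hy
    · intro hy; simpa using hsymm _ hy
  · rw [two_le_genus_iff]
    refine ⟨?_, fun h => hnc (contractible_of_oddMap A hne h)⟩
    obtain ⟨a, ha⟩ := hne
    obtain ⟨x, rfl⟩ := qP_isQuotientMap.surjective a
    exact ⟨x, x, ha, rfl⟩

theorem loops_le_kr (f : Proj B → ℝ) (hf : Continuous f) (F : B → ℝ)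
    (hF : ∀ x (hx : x ∈ sphere (0 : B) 1),
      F x = f (Quotient.mk (projSetoid B) ⟨x, hx⟩)) :
    (⨅ ℓ ∈ {ℓ : C(↥I, Proj B) | ℓ 0 = ℓ 1 ∧ ¬ NullHomotopicLoop ℓ},
      ⨆ s : ↥I, (f (ℓ s) : EReal)) ≤ kr F 2 := by
  refine le_iInf₂ ?_
  rintro A ⟨hAS, -, -, hgen⟩
  obtain ⟨-, hodd⟩ := (two_le_genus_iff A).1 hgen
  refine le_of_forall_gt_imp_ge_of_dense fun c hc => ?_
  let W : Set (↥({0}ᶜ : Set B)) := {y | (f (qP (nrm (y : B) y.2)) : EReal) < c}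
  have hW : IsOpen W := by
    refine isOpen_lt (continuous_coe_real_ereal.comp (hf.comp
      (qP_isQuotientMap.continuous.comp (continuous_nrm _ continuous_subtype_val _))))
      continuous_const
  let V : Set B := Subtype.val '' W
  have hV : IsOpen V := isOpen_compl_singleton.isOpenMap_subtype_val _ hW
  have hVmem : ∀ y : B, y ∈ V ↔ ∃ h : y ≠ 0, (f (qP (nrm y h)) : EReal) < c := by
    intro y
    constructor
    · rintro ⟨x, hx, rfl⟩; exact ⟨x.2, hx⟩
    · rintro ⟨h, hy⟩; exact ⟨⟨y, h⟩, hy, rfl⟩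
  have hneg : ∀ y ∈ V, -y ∈ V := by
    intro y hy
    obtain ⟨h, hy⟩ := (hVmem y).1 hy
    refine (hVmem _).2 ⟨neg_ne_zero.2 h, ?_⟩
    rw [nrm_neg y h, qP_neg]
    exact hy
  have hAV : A ⊆ V := by
    intro x hx
    have hxs := hAS hx
    refine (hVmem x).2 ⟨sphere_coe_ne ⟨x, hxs⟩, ?_⟩
    rw [nrm_self ⟨x, hxs⟩]
    have : (F x : EReal) < c :=
      (le_iSup₂ (f := fun (y : B) (_ : y ∈ A) => (F y : EReal)) x hx).trans_lt hc
    rw [hF x hxs] at this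
    exact this
  rcases path_or_odd V hV hneg with ⟨x, hx⟩ | ⟨g, hg, hg0, hgo⟩
  · obtain ⟨γ, hγ⟩ := hx
    have h0 : ∀ t, γ t ≠ 0 := fun t => ((hVmem _).1 (hγ t)).1
    let δ : C(↥I, ↥(sphere (0 : B) 1)) :=
      ⟨fun t => nrm (γ t) (h0 t), continuous_nrm _ γ.continuous h0⟩
    let ℓ : C(↥I, Proj B) := ⟨fun t => qP (δ t), qP_isQuotientMap.continuous.comp δ.continuous⟩
    have hδ : δ 1 = -δ 0 := by
      have hx0 : x ≠ 0 := by simpa using h0 0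
      show nrm (γ 1) (h0 1) = -nrm (γ 0) (h0 0)
      simp only [γ.source, γ.target]
      exact nrm_neg x hx0 _
    have hl : ℓ 0 = ℓ 1 := by
      show qP (δ 0) = qP (δ 1)
      rw [hδ, qP_neg]
    refine (iInf₂_le ℓ ⟨hl, not_null_of_antipodal δ hδ ℓ fun _ => rfl⟩).trans ?_
    · refine iSup_le fun s => ?_
      exact ((hVmem _).1 (hγ s)).2.le
  · exfalso
    refine hodd ⟨fun x _ => g ⟨x, hAV x.2⟩, ?_, ?_, ?_⟩
    · exact continuous_pi fun _ => hg.comp (by fun_prop)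
    · intro x h
      exact hg0 _ (congr_fun h 0)
    · intro x hx
      funext i
      exact hgo ⟨x, hAV x.2⟩

/-- The second Krasnoselskii eigenvalue and the second category eigenvalue agree and are
given by a min-max over non-contractible loops in projective space. -/
theorem kr2_eq_hs2_eq_inf_over_loops [CompleteSpace B]
    (f : Proj B → ℝ) (hf : Continuous f)
    (F : B → ℝ)
    (hF : ∀ x (hx : x ∈ sphere (0 : B) 1),
      F x = f (Quotient.mk (projSetoid B) ⟨x, hx⟩)) :
    kr F 2 = hs f 2 ∧
    hs f 2 = ⨅ ℓ ∈ {ℓ : C(↥I, Proj B) | ℓ 0 = ℓ 1 ∧ ¬ NullHomotopicLoop ℓ},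
      ⨆ s : ↥I, (f (ℓ s) : EReal) := by
  have h1 := hs_le_loops f hf
  have h2 := kr_le_hs f F hF
  have h3 := loops_le_kr f hf F hF
  exact ⟨le_antisymm h2 (h1.trans h3), le_antisymm h1 (h3.trans h2)⟩

end
end

section
/- The Lusternik–Schnirelmann subspace category of Dyck's surface ℝP² # T (the connected sum of the real projective plane and the torus), embedded suitably in ℝP³, equals 3. -/
open Set Metric Topology unitInterval

noncomputable section
open Classical

variable {B : Type*} [NormedAddCommGroup B] [NormedSpace ℝ B]

/-- The gluing relation for the hexagon word `aabbcc`: a boundary point at angle `θ`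
in one of the three even arcs is identified with the point at angle `θ + π/3`. -/
def dyckRel (z w : ℂ) : Prop :=
  ∃ k : Fin 3, ∃ θ : ℝ,
    θ ∈ Set.Icc ((2 * (k : ℝ)) * Real.pi / 3) ((2 * (k : ℝ)) * Real.pi / 3 + Real.pi / 3) ∧
    z = Complex.exp (θ * Complex.I) ∧ w = Complex.exp ((θ + Real.pi / 3) * Complex.I)

/-- Dyck's surface `ℝP² # T` (the non-orientable surface of non-orientable genus 3),
realized as the hexagon (here, the closed unit disc) with boundary word `aabbcc`. -/
def DyckSurface :=
  Quot (fun z w : ↥(Metric.closedBall (0 : ℂ) 1) => dyckRel (z : ℂ) (w : ℂ))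

instance : TopologicalSpace DyckSurface := instTopologicalSpaceQuot

theorem transport_aux {𝕜 V X : Type*} [RCLike 𝕜] [NormedAddCommGroup V] [NormedSpace 𝕜 V]
    [TopologicalSpace X] [CompactSpace X] (P : X → I → V →L[𝕜] V)
    (hP : Continuous (fun p : X × I => P p.1 p.2))
    (hidem : ∀ x t v, P x t (P x t v) = P x t v)
    (F0 : X → V) (hF0 : Continuous F0) (h0 : ∀ x, P x 0 (F0 x) = F0 x) (hne : ∀ x, F0 x ≠ 0) :
    ∃ F1 : X → V, Continuous F1 ∧ (∀ x, P x 1 (F1 x) = F1 x) ∧ (∀ x, F1 x ≠ 0) ∧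
      ∀ x y, (∀ t, P x t = P y t) → F0 y = -F0 x → F1 y = -F1 x := by
  let good : I → Prop := fun s => ∃ F1 : X → V, Continuous F1 ∧ (∀ x, P x s (F1 x) = F1 x) ∧
      (∀ x, F1 x ≠ 0) ∧ ∀ x y, (∀ t, P x t = P y t) → F0 y = -F0 x → F1 y = -F1 x
  let Q : C(I, C(X, V →L[𝕜] V)) :=
    ContinuousMap.curry ⟨fun p : I × X => P p.2 p.1, hP.comp continuous_swap⟩
  have hQ : ∀ s x, Q s x = P x s := fun s x => rfl
  have step : ∀ s t, dist (Q s) (Q t) < 1 → good s → good t := by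
    rintro s t hst ⟨F, hFc, hFP, hFne, hFo⟩
    refine ⟨fun x => P x t (F x), ?_, fun x => hidem _ _ _, ?_, ?_⟩
    · have : Continuous fun x => P x t := hP.comp (by fun_prop : Continuous fun x : X => (x, t))
      exact this.clm_apply hFc
    · intro x hx
      have h1 : ‖P x s - P x t‖ < 1 := by
        rw [← dist_eq_norm, ← hQ, ← hQ]
        exact lt_of_le_of_lt (ContinuousMap.dist_apply_le_dist x) hst
      have h2 : (P x s - P x t) (F x) = F x := by
        simp [hFP, hx]
      have h3 := (P x s - P x t).le_opNorm (F x)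
      rw [h2] at h3
      have h4 : 0 < ‖F x‖ := norm_pos_iff.mpr (hFne x)
      nlinarith
    · intro x y h h'
      simp only [← h t, hFo x y h h', map_neg]
  have hnb : ∀ s, ∀ᶠ t in 𝓝 s, dist (Q t) (Q s) < 1 := fun s =>
    Metric.tendsto_nhds.mp (Q.continuous.tendsto s) 1 one_pos
  have hclopen : IsClopen {s | good s} := by
    constructor
    · rw [← isOpen_compl_iff, isOpen_iff_mem_nhds]
      intro s hs
      filter_upwards [hnb s] with t ht hg
      exact hs (step t s ht hg)
    · rw [isOpen_iff_mem_nhds]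
      intro s hs
      filter_upwards [hnb s] with t ht
      exact step s t (by rwa [dist_comm]) hs
  have huniv := hclopen.eq_univ ⟨0, F0, hF0, h0, hne, fun _ _ _ h => h⟩
  have : (1 : I) ∈ {s | good s} := by rw [huniv]; trivial
  exact this

/-- The rank one projection attached to a point of `ℝ × 𝕜`. -/
def pauliProj {𝕜 : Type*} [RCLike 𝕜] (a : ℝ) (b : 𝕜) : (𝕜 × 𝕜) →L[𝕜] (𝕜 × 𝕜) :=
  ((1 + (a : 𝕜)) / 2) • ((ContinuousLinearMap.inl 𝕜 𝕜 𝕜).comp (ContinuousLinearMap.fst 𝕜 𝕜 𝕜)) +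
  ((starRingEnd 𝕜 b) / 2) •
    ((ContinuousLinearMap.inl 𝕜 𝕜 𝕜).comp (ContinuousLinearMap.snd 𝕜 𝕜 𝕜)) +
  (b / 2) • ((ContinuousLinearMap.inr 𝕜 𝕜 𝕜).comp (ContinuousLinearMap.fst 𝕜 𝕜 𝕜)) +
  ((1 - (a : 𝕜)) / 2) • ((ContinuousLinearMap.inr 𝕜 𝕜 𝕜).comp (ContinuousLinearMap.snd 𝕜 𝕜 𝕜))

theorem pauliProj_apply {𝕜 : Type*} [RCLike 𝕜] (a : ℝ) (b : 𝕜) (v : 𝕜 × 𝕜) :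
    pauliProj a b v = ((1 + (a : 𝕜)) / 2 * v.1 + (starRingEnd 𝕜 b) / 2 * v.2,
      b / 2 * v.1 + (1 - (a : 𝕜)) / 2 * v.2) := by
  simp [pauliProj]

theorem pauliProj_continuous {𝕜 : Type*} [RCLike 𝕜] :
    Continuous (fun p : ℝ × 𝕜 => pauliProj p.1 p.2) := by
  unfold pauliProj
  have h1 : Continuous fun p : ℝ × 𝕜 => (p.1 : 𝕜) := RCLike.continuous_ofReal.comp continuous_fst
  have h2 : Continuous fun p : ℝ × 𝕜 => starRingEnd 𝕜 p.2 :=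
    RCLike.continuous_conj.comp continuous_snd
  fun_prop

theorem pauliProj_idem {𝕜 : Type*} [RCLike 𝕜] (a : ℝ) (b : 𝕜) (h : a ^ 2 + ‖b‖ ^ 2 = 1)
    (v : 𝕜 × 𝕜) : pauliProj a b (pauliProj a b v) = pauliProj a b v := by
  have h' : (a : 𝕜) ^ 2 + (starRingEnd 𝕜 b) * b = 1 := by
    rw [RCLike.conj_mul]; exact_mod_cast congrArg (fun r : ℝ => (r : 𝕜)) h
  simp only [pauliProj_apply, Prod.mk.injEq]
  constructor
  · linear_combination (v.1 / 4) * h'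
  · linear_combination (v.2 / 4) * h'

theorem pauli_indep {𝕜 : Type*} [RCLike 𝕜] (a : ℝ) (b : 𝕜) (v w : 𝕜 × 𝕜)
    (hv : pauliProj a b v = v) (hw : pauliProj (-a) (-b) w = w) (hv0 : v ≠ 0) (hw0 : w ≠ 0) :
    v.1 * w.2 - v.2 * w.1 ≠ 0 := by
  intro hd
  obtain ⟨z, w'⟩ := v
  obtain ⟨x, y⟩ := w
  simp only [pauliProj_apply, Prod.mk.injEq, map_neg] at hv hw
  simp only at hd
  obtain ⟨e1, e2⟩ := hv
  obtain ⟨e3, e4⟩ := hw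
  have k1 : z * x = 0 := by
    linear_combination (-x) * e1 - z * e3 - (starRingEnd 𝕜 b) / 2 * hd
  have k2 : w' * y = 0 := by
    linear_combination (-y) * e2 - w' * e4 + b / 2 * hd
  by_cases hz : z = 0
  · have hw' : w' ≠ 0 := by
      rintro rfl; exact hv0 (by rw [hz]; rfl)
    have hy : y = 0 := by simpa [hw'] using k2
    have hx : x = 0 := by
      rw [hz, hy] at hd; simpa [hw'] using hd
    exact hw0 (by rw [hx, hy]; rfl)
  · have hx : x = 0 := by simpa [hz] using k1
    have hy : y = 0 := by
      rw [hx] at hd; simpa [hz] using hd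
    exact hw0 (by rw [hx, hy]; rfl)

theorem bu_step (𝕜 : Type*) [RCLike 𝕜] {E : Type*} [NormedAddCommGroup E] [NormedSpace ℝ E]
    [ProperSpace E] (f : E × ℝ → ℝ × 𝕜) (hc : ContinuousOn f {0}ᶜ) (hne : ∀ v, v ≠ 0 → f v ≠ 0)
    (hodd : ∀ v, v ≠ 0 → f (-v) = -f v) :
    ∃ g : E → 𝕜, ContinuousOn g {0}ᶜ ∧ (∀ v, v ≠ 0 → g v ≠ 0) ∧
      ∀ v, v ≠ 0 → g (-v) = -g v := by
  let X := sphere (0 : E) 1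
  have hX0 : ∀ x : X, (x : E) ≠ 0 := fun x => ne_zero_of_mem_unit_sphere x
  let q : X × I → E × ℝ := fun p => ((p.2 : ℝ) • (p.1 : E), 1 - (p.2 : ℝ))
  have hq : Continuous q := by fun_prop
  have hq0 : ∀ p, q p ≠ 0 := by
    intro p hp
    have h1 : (p.2 : ℝ) • (p.1 : E) = 0 := congrArg Prod.fst hp
    have h2 : 1 - (p.2 : ℝ) = 0 := congrArg Prod.snd hp
    rcases smul_eq_zero.mp h1 with h | h
    · rw [h] at h2; norm_num at h2
    · exact hX0 _ h
  let h : X × I → ℝ × 𝕜 := fun p => f (q p)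
  have hh : Continuous h := hc.comp_continuous hq hq0
  let r : X × I → ℝ := fun p => √((h p).1 ^ 2 + ‖(h p).2‖ ^ 2)
  have hrpos : ∀ p, 0 < (h p).1 ^ 2 + ‖(h p).2‖ ^ 2 := by
    intro p
    by_contra hcon
    have h1 : (h p).1 = 0 := by nlinarith [sq_nonneg (h p).1, sq_nonneg ‖(h p).2‖]
    have h2 : ‖(h p).2‖ = 0 := by nlinarith [sq_nonneg (h p).1, sq_nonneg ‖(h p).2‖]
    exact hne _ (hq0 p) (Prod.ext h1 (norm_eq_zero.mp h2))
  have hr : Continuous r := by fun_prop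
  have hr0 : ∀ p, r p ≠ 0 := fun p => (Real.sqrt_pos.mpr (hrpos p)).ne'
  let u : X × I → ℝ × 𝕜 := fun p => (r p)⁻¹ • h p
  have hu : Continuous u := (hr.inv₀ hr0).smul hh
  have hu1 : ∀ p, (u p).1 ^ 2 + ‖(u p).2‖ ^ 2 = 1 := by
    intro p
    have : r p ^ 2 = (h p).1 ^ 2 + ‖(h p).2‖ ^ 2 := Real.sq_sqrt (hrpos p).le
    simp only [u, Prod.smul_fst, Prod.smul_snd, norm_smul, smul_eq_mul, mul_pow, norm_inv,
      Real.norm_eq_abs, inv_pow, sq_abs]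
    rw [← mul_add, ← this]
    exact inv_mul_cancel₀ (pow_ne_zero 2 (hr0 p))
  by_cases hXe : Nonempty X
  swap
  · have : ∀ v : E, v = 0 := by
      intro v
      by_contra hv
      exact hXe ⟨⟨‖v‖⁻¹ • v, by simp [X, norm_smul, hv]⟩⟩
    refine ⟨0, continuousOn_const, fun v hv => absurd (this v) hv, fun v hv => absurd (this v) hv⟩
  obtain ⟨x₀⟩ := hXe
  have hconst : ∀ x : X, u (x, 0) = u (x₀, 0) := by
    intro x; simp [u, r, h, q]
  obtain ⟨v0, hv0, hv0'⟩ : ∃ v0 : 𝕜 × 𝕜, v0 ≠ 0 ∧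
      pauliProj (u (x₀, 0)).1 (u (x₀, 0)).2 v0 = v0 := by
    set a := (u (x₀, 0)).1 with ha
    set b := (u (x₀, 0)).2 with hb
    by_cases h1 : (1 + (a : 𝕜)) = 0
    · refine ⟨pauliProj a b (0, 1), ?_, pauliProj_idem _ _ (hu1 _) _⟩
      intro h2
      rw [pauliProj_apply] at h2
      have h3 := congrArg Prod.snd h2
      simp at h3
      have : (2 : 𝕜) = 0 := by linear_combination h1 + h3
      norm_num at this
    · refine ⟨pauliProj a b (1, 0), ?_, pauliProj_idem _ _ (hu1 _) _⟩
      intro h2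
      rw [pauliProj_apply] at h2
      have h3 := congrArg Prod.fst h2
      simp at h3
      exact h1 h3
  obtain ⟨F, hFc, hFP, hF0, -⟩ := transport_aux (𝕜 := 𝕜) (V := 𝕜 × 𝕜) (X := X)
    (fun x t => pauliProj (u (x, t)).1 (u (x, t)).2)
    (pauliProj_continuous.comp hu) (fun x t v => pauliProj_idem _ _ (hu1 _) v)
    (fun _ => v0) continuous_const (fun x => by rw [hconst x]; exact hv0') (fun _ => hv0)
  have hneg : ∀ x : X, u (-x, 1) = -u (x, 1) := by
    intro x
    have hxn : ((-x : X) : E) = -(x : E) := rfl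
    have hqn : q (-x, 1) = -q (x, 1) := by simp [q, hxn]
    have hhn : h (-x, 1) = - h (x, 1) := by
      simp only [h]; rw [hqn]; exact hodd _ (hq0 _)
    have hrn : r (-x, 1) = r (x, 1) := by simp [r, hhn]
    simp only [u, hrn, hhn, smul_neg]
  let lam : X → 𝕜 := fun x => (F x).1 * (F (-x)).2 - (F x).2 * (F (-x)).1
  have hlamc : Continuous lam := by
    have : Continuous fun x => F (-x) := hFc.comp continuous_neg
    fun_prop
  have hlam0 : ∀ x, lam x ≠ 0 := by
    intro x
    refine pauli_indep (u (x, 1)).1 (u (x, 1)).2 _ _ (hFP x) ?_ (hF0 x) (hF0 _)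
    have := hFP (-x)
    rwa [hneg] at this
  have hlamodd : ∀ x, lam (-x) = - lam x := by
    intro x; simp only [lam, neg_neg]; ring
  have hmem : ∀ v : E, v ≠ 0 → ‖v‖⁻¹ • v ∈ X := by
    intro v hv; simp [X, norm_smul, hv]
  refine ⟨fun v => if hv : v ≠ 0 then lam ⟨‖v‖⁻¹ • v, hmem v hv⟩ else 0, ?_, ?_, ?_⟩
  · rw [continuousOn_iff_continuous_domRestrict]
    have : (({0}ᶜ : Set E).domRestrict
        fun v => if hv : v ≠ 0 then lam ⟨‖v‖⁻¹ • v, hmem v hv⟩ else 0) =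
        fun v : ({0}ᶜ : Set E) => lam ⟨‖(v : E)‖⁻¹ • (v : E), hmem v v.2⟩ := by
      funext v
      exact dif_pos v.2
    rw [this]
    refine hlamc.comp (Continuous.subtype_mk ?_ _)
    refine Continuous.smul (Continuous.inv₀ (by fun_prop) ?_) continuous_subtype_val
    intro v; exact norm_ne_zero_iff.mpr v.2
  · intro v hv
    simp only [hv, ne_eq, not_false_eq_true, dite_true]
    exact hlam0 _
  · intro v hv
    have hv' : -v ≠ 0 := neg_ne_zero.mpr hv
    simp only [hv, hv', ne_eq, not_false_eq_true, dite_true]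
    rw [← hlamodd]
    congr 1
    apply Subtype.ext
    change ‖-v‖⁻¹ • (-v) = -(‖v‖⁻¹ • v)
    simp

theorem bu_three (f : ((ℝ × ℝ) × ℝ) × ℝ → ℝ × ℂ) (hc : ContinuousOn f {0}ᶜ)
    (hne : ∀ v, v ≠ 0 → f v ≠ 0) (hodd : ∀ v, v ≠ 0 → f (-v) = -f v) : False := by
  obtain ⟨g, gc, gne, godd⟩ := bu_step ℂ f hc hne hodd
  obtain ⟨k, kc, kne, kodd⟩ := bu_step ℝ (fun v => ((g v).re, (g v).im))
    ((Complex.continuous_re.comp_continuousOn gc).prodMk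
      (Complex.continuous_im.comp_continuousOn gc))
    (fun v hv h => gne v hv (Complex.ext (congrArg Prod.fst h) (congrArg Prod.snd h)))
    (fun v hv => by simp [godd v hv])
  have hconn : IsPreconnected ({0}ᶜ : Set (ℝ × ℝ)) := by
    refine (isConnected_compl_singleton_of_one_lt_rank ?_ 0).isPreconnected
    rw [rank_prod', Module.rank_self]
    norm_num
  have h1 : ((1 : ℝ), (0 : ℝ)) ≠ 0 := by simp
  have h1' : -((1 : ℝ), (0 : ℝ)) ≠ 0 := neg_ne_zero.mpr h1
  have hk := kodd _ h1
  rcases lt_or_gt_of_ne (kne _ h1) with h | h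
  · obtain ⟨v, hv, hv0⟩ := hconn.intermediate_value (a := (1, 0)) (b := -(1, 0)) h1 h1' kc
      (show (0 : ℝ) ∈ Icc _ _ from ⟨h.le, by rw [hk]; linarith⟩)
    exact kne v hv hv0
  · obtain ⟨v, hv, hv0⟩ := hconn.intermediate_value (a := -(1, 0)) (b := (1, 0)) h1' h1 kc
      (show (0 : ℝ) ∈ Icc _ _ from ⟨by rw [hk]; linarith, h.le⟩)
    exact kne v hv hv0

abbrev E4 := EuclideanSpace ℝ (Fin 4)

theorem bu_sphere (s : Fin 3 → ↥(sphere (0 : E4) 1) → ℝ) (hc : ∀ i, Continuous (s i))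
    (hodd : ∀ i x, s i (-x) = -s i x) : ∃ x, ∀ i, s i x = 0 := by
  by_contra hcon
  let w : ((ℝ × ℝ) × ℝ) × ℝ → E4 := fun v => !₂[v.1.1.1, v.1.1.2, v.1.2, v.2]
  have hw : Continuous w := by fun_prop
  have hwneg : ∀ v, w (-v) = - w v := by
    intro v; ext i; fin_cases i <;> simp [w]
  have hw0 : ∀ v, v ≠ 0 → w v ≠ 0 := by
    intro v hv h
    apply hv
    have h0 := congrArg (fun z : E4 => z 0) h
    have h1 := congrArg (fun z : E4 => z 1) h
    have h2 := congrArg (fun z : E4 => z 2) h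
    have h3 := congrArg (fun z : E4 => z 3) h
    simp [w] at h0 h1 h2 h3
    ext <;> simp [h0, h1, h2, h3]
  have hmem : ∀ v, v ≠ 0 → ‖w v‖⁻¹ • w v ∈ sphere (0 : E4) 1 := by
    intro v hv; simp [norm_smul, hw0 v hv]
  let G : ↥(sphere (0 : E4) 1) → ℝ × ℂ := fun x => (s 0 x, ⟨s 1 x, s 2 x⟩)
  have hG : Continuous G := by
    refine (hc 0).prodMk ?_
    have : (fun x => (⟨s 1 x, s 2 x⟩ : ℂ)) = fun x => (s 1 x : ℂ) + s 2 x * Complex.I := by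
      funext x; exact Complex.mk_eq_add_mul_I _ _
    rw [this]
    have := hc 1
    have := hc 2
    fun_prop
  refine bu_three (fun v => if hv : v ≠ 0 then G ⟨‖w v‖⁻¹ • w v, hmem v hv⟩ else 0) ?_ ?_ ?_
  · rw [continuousOn_iff_continuous_domRestrict]
    have : (({0}ᶜ : Set (((ℝ × ℝ) × ℝ) × ℝ)).domRestrict
        fun v => if hv : v ≠ 0 then G ⟨‖w v‖⁻¹ • w v, hmem v hv⟩ else 0) =
        fun v : ({0}ᶜ : Set (((ℝ × ℝ) × ℝ) × ℝ)) => G ⟨‖w v‖⁻¹ • w v, hmem v v.2⟩ := by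
      funext v
      exact dif_pos v.2
    rw [this]
    refine hG.comp (Continuous.subtype_mk ?_ _)
    have hwv : Continuous fun v : ({0}ᶜ : Set (((ℝ × ℝ) × ℝ) × ℝ)) => w v :=
      hw.comp continuous_subtype_val
    exact (hwv.norm.inv₀ fun v => norm_ne_zero_iff.mpr (hw0 _ v.2)).smul hwv
  · intro v hv
    simp only [hv, ne_eq, not_false_eq_true, dite_true]
    intro h
    apply hcon
    refine ⟨⟨‖w v‖⁻¹ • w v, hmem v hv⟩, ?_⟩
    have h0 := congrArg Prod.fst h
    have h1 := congrArg (fun p => p.2.re) h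
    have h2 := congrArg (fun p => p.2.im) h
    intro i
    fin_cases i
    · exact h0
    · exact h1
    · exact h2
  · intro v hv
    have hv' : -v ≠ 0 := neg_ne_zero.mpr hv
    simp only [hv, hv', ne_eq, not_false_eq_true, dite_true]
    have : (⟨‖w (-v)‖⁻¹ • w (-v), hmem _ hv'⟩ : ↥(sphere (0 : E4) 1)) =
        -⟨‖w v‖⁻¹ • w v, hmem v hv⟩ := by
      ext1; simp [hwneg]
    rw [this]
    simp only [G, hodd]
    exact Prod.ext rfl (Complex.ext rfl rfl)

/-- The quotient map. -/
def toProj (x : ↥(sphere (0 : E4) 1)) : Proj E4 := Quotient.mk (projSetoid E4) x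

theorem toProj_continuous : Continuous toProj := continuous_quot_mk

theorem toProj_surj : Function.Surjective toProj := Quot.mk_surjective

theorem toProj_eq (x y : ↥(sphere (0 : E4) 1)) :
    toProj x = toProj y ↔ (x : E4) = y ∨ (x : E4) = -(y : E4) := Quotient.eq (r := projSetoid E4)

theorem toProj_neg (x : ↥(sphere (0 : E4) 1)) : toProj (-x) = toProj x :=
  (toProj_eq _ _).mpr (Or.inr rfl)

/-- Orthogonal projection to a line. -/
def lineProj : Proj E4 → (E4 →L[ℝ] E4) :=
  Quotient.lift (fun x : ↥(sphere (0 : E4) 1) => (innerSL ℝ (x : E4)).smulRight (x : E4)) (by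
    rintro x y (h | h)
    · simp only [h]
    · ext1 v; simp [h])

theorem lineProj_toProj (x : ↥(sphere (0 : E4) 1)) (v : E4) :
    lineProj (toProj x) v = (inner ℝ (x : E4) v) • (x : E4) := rfl

theorem lineProj_continuous : Continuous lineProj := by
  refine Continuous.quotient_lift (s := projSetoid E4) ?_ _
  have : Continuous fun p : E4 => (innerSL ℝ p).smulRight p := by
    have h : (fun p : E4 => (innerSL ℝ p).smulRight p) =
      fun p => ContinuousLinearMap.smulRightL ℝ E4 E4 (innerSL ℝ p) p := rfl
    rw [h]
    fun_prop
  exact this.comp continuous_subtype_val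

theorem odd_of_contractible (C : Set (Proj E4)) (hC : IsClosed C) (hcon : ContractibleIn C) :
    ∃ s : ↥(sphere (0 : E4) 1) → ℝ, Continuous s ∧ (∀ x, s (-x) = -s x) ∧
      ∀ x, toProj x ∈ C → s x ≠ 0 := by
  obtain ⟨x₀, H, H0, H1⟩ := hcon
  obtain ⟨y₀, rfl⟩ := toProj_surj x₀
  let K : Set ↥(sphere (0 : E4) 1) := toProj ⁻¹' C
  have hK : IsClosed K := hC.preimage toProj_continuous
  have : CompactSpace K := isCompact_iff_compactSpace.mp hK.isCompact
  let π : K → C := fun x => ⟨toProj x, x.2⟩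
  have hπ : Continuous π := (toProj_continuous.comp continuous_subtype_val).subtype_mk _
  obtain ⟨F, hFc, hFP, hF0, hFo⟩ := transport_aux (𝕜 := ℝ) (V := E4) (X := K)
    (fun x t => lineProj (H (π x, t)))
    (lineProj_continuous.comp (H.continuous.comp (by fun_prop)))
    (by
      intro x t v
      obtain ⟨y, hy⟩ := toProj_surj (H (π x, t))
      rw [← hy]
      simp only [lineProj_toProj, inner_smul_right]
      rw [real_inner_self_eq_norm_sq, norm_eq_of_mem_sphere]
      simp)
    (fun x => ((x : ↥(sphere (0 : E4) 1)) : E4)) (by fun_prop)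
    (by
      intro x
      rw [H0]
      simp only [π, lineProj_toProj]
      rw [real_inner_self_eq_norm_sq, norm_eq_of_mem_sphere]
      simp)
    (fun x => ne_zero_of_mem_unit_sphere _)
  have hneg : ∀ x ∈ K, -x ∈ K := fun x hx => by
    simp only [K, mem_preimage, toProj_neg]; exact hx
  let g : C(K, ℝ) := ⟨fun x => inner ℝ (y₀ : E4) (F x), by fun_prop⟩
  have hg0 : ∀ x, g x ≠ 0 := by
    intro x hx
    have h1 := hFP x
    rw [H1, lineProj_toProj] at h1
    have hx' : inner ℝ (y₀ : E4) (F x) = 0 := hx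
    rw [hx', zero_smul] at h1
    exact hF0 x h1.symm
  have hgodd : ∀ (x : K), g ⟨-x, hneg x x.2⟩ = - g x := by
    intro x
    have : F ⟨-x, hneg x x.2⟩ = -F x := by
      apply hFo
      · intro t
        have : π ⟨-x, hneg x x.2⟩ = π x := Subtype.ext (toProj_neg _)
        rw [this]
      · rfl
    change inner ℝ (y₀ : E4) (F _) = - inner ℝ (y₀ : E4) (F x)
    rw [this, inner_neg_right]
  obtain ⟨G, hG⟩ := g.exists_restrict_eq hK
  have hG' : ∀ x (hx : x ∈ K), G x = g ⟨x, hx⟩ := fun x hx =>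
    congrArg (fun f : C(K, ℝ) => f ⟨x, hx⟩) hG
  refine ⟨fun x => G x - G (-x), by fun_prop, fun x => by simp, ?_⟩
  intro x hx
  have e1 := hG' x hx
  have e2 := hG' (-x) (hneg x hx)
  have e3 := hgodd ⟨x, hx⟩
  have e4 := hg0 ⟨x, hx⟩
  simp only at e3
  intro h
  apply e4
  simp only [e1, e2] at h
  rw [e3] at h
  linarith

theorem no_three_cover (C : Fin 3 → Set (Proj E4)) (hC : ∀ i, IsClosed (C i))
    (hcon : ∀ i, ContractibleIn (C i)) (hcov : ∀ x, ∃ i, x ∈ C i) : False := by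
  choose s hs hodd hne using fun i => odd_of_contractible (C i) (hC i) (hcon i)
  obtain ⟨x, hx⟩ := bu_sphere s hs hodd
  obtain ⟨i, hi⟩ := hcov (toProj x)
  exact hne i x hi (hx i)

/-- Sets where a linear functional is nonzero are contractible. -/
theorem contractible_of_functional (l : E4 →L[ℝ] ℝ) (v : E4) (hv : l v = 1)
    (C : Set (Proj E4)) (hC : ∀ x, toProj x ∈ C → l x ≠ 0) : ContractibleIn C := by
  let q : Proj E4 → E4 := Quotient.lift (fun x : ↥(sphere (0 : E4) 1) => l x • (x : E4)) (by
    rintro x y (h | h)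
    · simp only [h]
    · simp [h])
  have hqx : ∀ x, q (toProj x) = l x • (x : E4) := fun x => rfl
  have hq : Continuous q := by
    refine Continuous.quotient_lift (s := projSetoid E4) ?_ _
    fun_prop
  let m : C × I → E4 := fun p => (1 - (p.2 : ℝ)) • q p.1 + (p.2 : ℝ) • v
  have hm : Continuous m := by fun_prop
  have hm0 : ∀ p, m p ≠ 0 := by
    rintro ⟨⟨c, hc⟩, t⟩ h
    obtain ⟨x, rfl⟩ := toProj_surj c
    have h1 := congrArg l h
    simp only [m, hqx, map_add, map_smul, hv, smul_eq_mul, mul_one, map_zero] at h1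
    have h2 : 0 < l x * l x := mul_self_pos.mpr (hC x hc)
    have h3 := t.2.1
    have h4 := t.2.2
    rcases h3.eq_or_lt with h5 | h5
    · rw [← h5] at h1; linarith
    · nlinarith
  have hmem : ∀ p, ‖m p‖⁻¹ • m p ∈ sphere (0 : E4) 1 := by
    intro p; simp [norm_smul, hm0 p]
  have hv0 : v ≠ 0 := by rintro rfl; simp at hv
  refine ⟨toProj ⟨‖v‖⁻¹ • v, by simp [norm_smul, hv0]⟩,
    ⟨fun p => toProj ⟨‖m p‖⁻¹ • m p, hmem p⟩, ?_⟩, ?_, ?_⟩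
  · refine toProj_continuous.comp (Continuous.subtype_mk ?_ _)
    exact (hm.norm.inv₀ fun p => norm_ne_zero_iff.mpr (hm0 p)).smul hm
  · rintro ⟨c, hc⟩
    obtain ⟨x, rfl⟩ := toProj_surj c
    have hl := hC x hc
    change toProj _ = toProj x
    rw [toProj_eq]
    have hx : ‖(x : E4)‖ = 1 := norm_eq_of_mem_sphere x
    have e : m (⟨toProj x, hc⟩, 0) = l x • (x : E4) := by simp [m, hqx]
    simp only [e, norm_smul, hx, mul_one, smul_smul, Real.norm_eq_abs]
    rcases lt_or_gt_of_ne hl with h | h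
    · right
      rw [abs_of_neg h, inv_neg, neg_mul, inv_mul_cancel₀ hl, neg_smul, one_smul]
    · left
      rw [abs_of_pos h, inv_mul_cancel₀ hl, one_smul]
  · rintro c
    have e : m (c, 1) = v := by simp [m]
    simp [e]

theorem cover_of_proper (D : Set (Proj E4)) (hD : IsClosed D) (hne : D ≠ univ) :
    ∃ C : Fin 3 → Set (Proj E4),
    (∀ i, IsClosed (C i)) ∧ (∀ i, ContractibleIn (C i)) ∧ D ⊆ ⋃ i, C i := by
  obtain ⟨d, hd⟩ := (ne_univ_iff_exists_notMem D).mp hne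
  obtain ⟨p, rfl⟩ := toProj_surj d
  have hp0 : (p : E4) ≠ 0 := ne_zero_of_mem_unit_sphere p
  obtain ⟨k, hk⟩ : ∃ k, (p : E4) k ≠ 0 := by
    by_contra! h
    exact hp0 (by ext i; simpa using h i)
  let j : Fin 3 → Fin 4 := k.succAbove
  let l : Fin 3 → E4 →L[ℝ] ℝ := fun i =>
    (EuclideanSpace.proj (j i) : E4 →L[ℝ] ℝ) -
      ((p : E4) (j i) / (p : E4) k) • (EuclideanSpace.proj k : E4 →L[ℝ] ℝ)
  have hl : ∀ i (x : E4), l i x = x (j i) - (p : E4) (j i) / (p : E4) k * x k := by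
    intro i x; simp [l]
  let a : Fin 3 → Proj E4 → ℝ := fun i =>
    Quotient.lift (fun x : ↥(sphere (0 : E4) 1) => |l i x|) (by
      rintro x y (h | h)
      · simp only [h]
      · simp only [h, map_neg, abs_neg])
  have hax : ∀ i x, a i (toProj x) = |l i x| := fun i x => rfl
  have ha : ∀ i, Continuous (a i) := by
    intro i
    refine Continuous.quotient_lift (s := projSetoid E4) ?_ _
    fun_prop
  have hzero : ∀ x, toProj x ∈ D → ∃ i, l i x ≠ 0 := by
    intro x hx
    by_contra! h
    have hxp : (x : E4) = ((x : E4) k / (p : E4) k) • (p : E4) := by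
      ext i
      rcases Fin.eq_self_or_eq_succAbove k i with rfl | ⟨i', rfl⟩
      · simp [hk]
      · have := h i'
        rw [hl] at this
        simp only [PiLp.smul_apply, smul_eq_mul]
        change _ - _ = _ at this
        simp only [j] at this
        linear_combination this
    have hn := congrArg norm hxp
    rw [norm_smul, norm_eq_of_mem_sphere, norm_eq_of_mem_sphere, mul_one, Real.norm_eq_abs] at hn
    apply hd
    have : toProj x = toProj p := by
      rw [toProj_eq]
      rcases eq_or_eq_neg_of_abs_eq hn.symm with h1 | h1
      · left; rw [hxp, h1, one_smul]
      · right; rw [hxp, h1, neg_smul, one_smul]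
    rwa [← this]
  refine ⟨fun i => D ∩ {c | ∀ i', a i' c ≤ a i c}, ?_, ?_, ?_⟩
  · intro i
    refine hD.inter ?_
    simp only [ofPred_forall]
    exact isClosed_iInter fun i' => isClosed_le (ha i') (ha i)
  · intro i
    refine contractible_of_functional (l i) (EuclideanSpace.single (j i) 1) ?_ _ ?_
    · rw [hl]
      have : k ≠ j i := (Fin.succAbove_ne k i).symm
      simp [this]
    · rintro x ⟨hx, hx'⟩ h0
      obtain ⟨i', hi'⟩ := hzero x hx
      have := hx' i'
      rw [hax, hax, h0, abs_zero] at this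
      exact hi' (abs_nonpos_iff.mp this)
  · intro c hc
    obtain ⟨i, hi⟩ := Finite.exists_max (fun i => a i c)
    exact mem_iUnion.mpr ⟨i, hc, hi⟩

/-- A suitably embedded copy of Dyck's surface `ℝP² # T` in `ℝP³` (one admitting a
tubular neighbourhood whose closure has the same category and whose complement is
contractible in `ℝP³`) has Lusternik–Schnirelmann subspace category 3 in `ℝP³`. -/
theorem catLS_dyckSurface_in_rp3
    (D : Set (Proj (EuclideanSpace ℝ (Fin 4)))) (hDcl : IsClosed D)
    (hDproper : D ≠ Set.univ)
    (hDdyck : ∃ e : DyckSurface → Proj (EuclideanSpace ℝ (Fin 4)),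
      Topology.IsEmbedding e ∧ D = Set.range e)
    (htub : ∃ U : Set (Proj (EuclideanSpace ℝ (Fin 4))), IsOpen U ∧ D ⊆ U ∧
      catLS (closure U) = catLS D ∧ ContractibleIn Uᶜ) :
    catLS D = 3 := by
  apply le_antisymm
  · obtain ⟨C, h1, h2, h3⟩ := cover_of_proper D hDcl hDproper
    exact sInf_le ⟨3, rfl, C, h1, h2, h3⟩
  · obtain ⟨U, hU, -, hcat, hUc⟩ := htub
    rw [← hcat]
    refine le_sInf ?_
    rintro m ⟨k, rfl, C, h1, h2, h3⟩
    by_contra hlt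
    have hk : k < 3 := by
      rw [not_le] at hlt
      exact_mod_cast hlt
    refine no_three_cover (fun i => if h : (i : ℕ) < k then C ⟨i, h⟩ else Uᶜ) ?_ ?_ ?_
    · intro i
      split_ifs with h
      · exact h1 _
      · exact hU.isClosed_compl
    · intro i
      split_ifs with h
      · exact h2 _
      · exact hUc
    · intro x
      by_cases hx : x ∈ U
      · obtain ⟨i, hi⟩ := mem_iUnion.mp (h3 (subset_closure hx))
        refine ⟨⟨i, i.2.trans hk⟩, ?_⟩
        simpa using hi
      · refine ⟨⟨k, hk⟩, ?_⟩
        simpa using hx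

end
end
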